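/- There exist universal constants C_K > 0 and C_LT > 0 such that the following holds. Let α = μ/ν be a reduced fraction with μ ∈ ℤ odd and ν a positive integer, let N ≥ 2, and let u be a normalized N-anyon wave function with statistics parameter α and one-particle density ρ. Then (i) ∑_{j=1}^N ∫_{(ℝ²)^N} |D_j u|² dx ≥ (1/ν²) · C_K · ∫_{ℝ²} ρ(x)² dx, and (ii) for every measurable V : ℝ² → ℝ whose negative part V₋ := max(−V,0) is square integrable, ∑_{j=1}^N ∫_{(ℝ²)^N} (|D_j u|² + V(x_j)|u|²) dx ≥ −ν² · C_LT · ∫_{ℝ²} V₋(x)² dx (the left-hand side interpreted as +∞ if the positive part of the potential term fails to be integrable). -/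

import Mathlib

open MeasureTheory

noncomputable section

/-- Squared magnitude of the covariant derivative `D_j u` at configuration `x`;
the plane `ℝ²` is identified with `ℂ` (so `a^⊥ = I·a`, and the two components of a
vector field are the real and imaginary parts). -/
def covSq (α : ℝ) {N : ℕ} (u : (Fin N → ℂ) → ℂ) (j : Fin N) (x : Fin N → ℂ) : ℝ :=
  let A : ℂ := (α : ℂ) * ∑ k ∈ Finset.univ.erase j,
    Complex.I * (x j - x k) / ((‖x j - x k‖ : ℂ) ^ 2)
  ‖-Complex.I * fderiv ℝ u x (Pi.single j 1) + (A.re : ℂ) * u x‖ ^ 2 +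
    ‖-Complex.I * fderiv ℝ u x (Pi.single j Complex.I) + (A.im : ℂ) * u x‖ ^ 2

/-- The statistics constant `C_{α,N} = min_{p ∈ {0,…,N-2}} min_{q ∈ ℤ} |(2p+1)α - 2q|`. -/
def statC (α : ℝ) (N : ℕ) : ℝ :=
  ⨅ p : Fin (N - 1), ⨅ q : ℤ, |(2 * ((p : ℕ) : ℝ) + 1) * α - 2 * (q : ℝ)|

/-- `N`-anyon wave function in the magnetic gauge (smooth compactly supported
form-core representative): totally symmetric with support away from the diagonals. -/
structure IsAnyonWF (N : ℕ) (u : (Fin N → ℂ) → ℂ) : Prop where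
  smooth : ContDiff ℝ (⊤ : ℕ∞) u
  compactSupport : HasCompactSupport u
  symmetric : ∀ (σ : Equiv.Perm (Fin N)) (x : Fin N → ℂ), u (x ∘ σ) = u x
  offDiagonal : ∀ x ∈ tsupport u, ∀ j k : Fin N, j ≠ k → x j ≠ x k

/-- One-particle density of an `N`-particle wave function. -/
def density (N : ℕ) (u : (Fin N → ℂ) → ℂ) (y : ℂ) : ℝ :=
  ∑ j : Fin N, ∫ z : {k : Fin N // k ≠ j} → ℂ,
    ‖u (fun k => if h : k = j then y else z ⟨k, h⟩)‖ ^ 2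

/-- The configuration whose `j`-th particle is at `y` and whose other particles are given by `z`. -/
def insertAt {N : ℕ} (j : Fin N) (y : ℂ) (z : {k : Fin N // k ≠ j} → ℂ) : Fin N → ℂ :=
  fun k => if h : k = j then y else z ⟨k, h⟩

@[simp]
theorem insertAt_self {N : ℕ} (j : Fin N) (y : ℂ) (z : {k : Fin N // k ≠ j} → ℂ) :
    insertAt j y z j = y := by
  simp [insertAt]

theorem insertAt_add_smul {N : ℕ} (j : Fin N) (y e : ℂ) (s : ℝ) (z : {k : Fin N // k ≠ j} → ℂ) :
    insertAt j (y + s • e) z = insertAt j y z + s • (Pi.single j e : Fin N → ℂ) := by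
  ext k
  by_cases h : k = j
  · subst h; simp [insertAt]
  · simp [insertAt, h]

theorem continuous_insertAt {N : ℕ} (j : Fin N) :
    Continuous (fun p : ℂ × ({k : Fin N // k ≠ j} → ℂ) => insertAt j p.1 p.2) := by
  refine continuous_pi fun k => ?_
  by_cases h : k = j
  · simpa [insertAt, h] using continuous_fst
  · simpa [insertAt, h] using
      (continuous_apply (⟨k, h⟩ : {k : Fin N // k ≠ j})).comp' continuous_snd

theorem measurePreserving_insertAt {N : ℕ} (j : Fin N) :
    MeasurePreserving (fun p : ℂ × ({k : Fin N // k ≠ j} → ℂ) => insertAt j p.1 p.2) := by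
  have h1 := (volume_preserving_piEquivPiSubtypeProd (fun _ : Fin N => ℂ) (fun k => k = j)).symm
  have h2 : MeasurePreserving (MeasurableEquiv.funUnique {k : Fin N // k = j} ℂ).symm volume
      (@Measure.pi _ _ (Subtype.fintype fun k => k = j) _ fun _ => volume) := by
    convert (measurePreserving_funUnique (volume : Measure ℂ) {k : Fin N // k = j}).symm
    rfl
  exact h1.comp (h2.prod (MeasurePreserving.id (volume : Measure ({k : Fin N // ¬k = j} → ℂ))))

theorem lintegral_insertAt {N : ℕ} (j : Fin N) {F : (Fin N → ℂ) → ENNReal} (hF : Measurable F) :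
    ∫⁻ x, F x = ∫⁻ p : ℝ × ℝ, ∫⁻ z, F (insertAt j (Complex.measurableEquivRealProd.symm p) z) := by
  rw [← (measurePreserving_insertAt j).lintegral_comp hF, Measure.volume_eq_prod,
    lintegral_prod (fun p => F (insertAt j p.1 p.2))
      (hF.comp (continuous_insertAt j).measurable).aemeasurable,
    ← Complex.volume_preserving_equiv_real_prod.symm.lintegral_comp]
  exact Measurable.lintegral_prod_right' (hF.comp (continuous_insertAt j).measurable)

/-- The sum over particles of the marginals of the functions `F j`, in real coordinates. -/
def marginal {N : ℕ} (F : Fin N → (Fin N → ℂ) → ENNReal) (p : ℝ × ℝ) : ENNReal :=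
  ∑ j, ∫⁻ z, F j (insertAt j (Complex.measurableEquivRealProd.symm p) z)

theorem measurable_insertAt_left {N : ℕ} (j : Fin N) {F : (Fin N → ℂ) → ENNReal}
    (hF : Measurable F) : Measurable (fun q : (ℝ × ℝ) × ({k : Fin N // k ≠ j} → ℂ) =>
      F (insertAt j (Complex.measurableEquivRealProd.symm q.1) q.2)) :=
  hF.comp ((continuous_insertAt j).measurable.comp
    ((Complex.measurableEquivRealProd.symm.measurable.comp measurable_fst).prodMk measurable_snd))

theorem measurable_marginal {N : ℕ} {F : Fin N → (Fin N → ℂ) → ENNReal}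
    (hF : ∀ j, Measurable (F j)) : Measurable (marginal F) :=
  Finset.measurable_sum _ fun j _ => (measurable_insertAt_left j (hF j)).lintegral_prod_right'

theorem lintegral_mul_marginal {N : ℕ} {F : Fin N → (Fin N → ℂ) → ENNReal}
    (hF : ∀ j, Measurable (F j)) {g : ℝ × ℝ → ENNReal} (hg : Measurable g) :
    ∫⁻ p, g p * marginal F p =
      ∑ j, ∫⁻ x : Fin N → ℂ, g (Complex.measurableEquivRealProd (x j)) * F j x := by
  simp only [marginal, Finset.mul_sum]
  rw [lintegral_finsetSum]
  · refine Finset.sum_congr rfl fun j _ => ?_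
    rw [lintegral_insertAt j]
    · refine lintegral_congr fun p => ?_
      rw [← lintegral_const_mul]
      · simp only [insertAt_self, MeasurableEquiv.apply_symm_apply]
      · exact (measurable_insertAt_left j (hF j)).comp measurable_prodMk_left
    · exact (hg.comp (Complex.measurableEquivRealProd.measurable.comp
        (measurable_pi_apply j))).mul (hF j)
  · exact fun j _ => hg.mul (measurable_insertAt_left j (hF j)).lintegral_prod_right'

theorem setLIntegral_marginal {N : ℕ} {F : Fin N → (Fin N → ℂ) → ENNReal}
    (hF : ∀ j, Measurable (F j)) {Q : Set (ℝ × ℝ)} (hQ : MeasurableSet Q) :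
    ∫⁻ p in Q, marginal F p =
      ∑ j, ∫⁻ x : Fin N → ℂ, Q.indicator 1 (Complex.measurableEquivRealProd (x j)) * F j x := by
  rw [← lintegral_mul_marginal hF (measurable_one.indicator hQ), ← lintegral_indicator hQ]
  refine lintegral_congr fun p => ?_
  by_cases h : p ∈ Q <;> simp [h]

theorem lintegral_marginal {N : ℕ} {F : Fin N → (Fin N → ℂ) → ENNReal}
    (hF : ∀ j, Measurable (F j)) :
    ∫⁻ p, marginal F p = ∑ j, ∫⁻ x : Fin N → ℂ, F j x := by
  simpa using lintegral_mul_marginal hF (measurable_const (a := (1 : ENNReal)))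

theorem const_mul_measure_le_lintegral_add {f : ℝ → ENNReal} (hf : Measurable f) {S : Set ℝ}
    (hS : MeasurableSet S) {c h : ENNReal} (hc : ∀ s ∈ S, c ≤ f s + h) :
    c * volume S ≤ (∫⁻ s in S, f s) + h * volume S := by
  calc c * volume S = ∫⁻ _ in S, c := by simp
    _ ≤ ∫⁻ s in S, (f s + h) := setLIntegral_mono' hS hc
    _ = _ := by rw [lintegral_add_left hf]; simp

theorem lintegral_le_three_mul_middle {f : ℝ → ENNReal} (hf : Measurable f) {a r : ℝ}
    (hr : 0 < r) {h : ENNReal}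
    (hc : ∀ s ∈ Set.Icc (a - 3 * r) (a + 3 * r), ∀ s' ∈ Set.Icc (a - 3 * r) (a + 3 * r),
      f s ≤ f s' + h) :
    ∫⁻ s in Set.Icc (a - 3 * r) (a + 3 * r), f s ≤
      3 * (∫⁻ s in Set.Icc (a - r) (a + r), f s) + ENNReal.ofReal (6 * r) * h := by
  have hsub : Set.Icc (a - r) (a + r) ⊆ Set.Icc (a - 3 * r) (a + 3 * r) :=
    Set.Icc_subset_Icc (by linarith) (by linarith)
  have hv : volume (Set.Icc (a - r) (a + r)) = ENNReal.ofReal (2 * r) := by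
    rw [Real.volume_Icc]; congr 1; ring
  have hv3 : volume (Set.Icc (a - 3 * r) (a + 3 * r)) = 3 * ENNReal.ofReal (2 * r) := by
    rw [Real.volume_Icc, ← ENNReal.ofReal_ofNat, ← ENNReal.ofReal_mul (by norm_num)]
    congr 1; ring
  have h6 : ENNReal.ofReal (6 * r) = 3 * ENNReal.ofReal (2 * r) := by
    rw [← ENNReal.ofReal_ofNat, ← ENNReal.ofReal_mul (by norm_num)]
    congr 1; ring
  have h0 : ENNReal.ofReal (2 * r) ≠ 0 := by simpa using hr
  have key : ∀ s ∈ Set.Icc (a - 3 * r) (a + 3 * r), f s * ENNReal.ofReal (2 * r) ≤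
      (∫⁻ s in Set.Icc (a - r) (a + r), f s) + h * ENNReal.ofReal (2 * r) := fun s hs => by
    rw [← hv]
    exact const_mul_measure_le_lintegral_add hf measurableSet_Icc
      fun s' hs' => hc s hs s' (hsub hs')
  have := setLIntegral_mono' (μ := volume) measurableSet_Icc key
  rw [lintegral_mul_const _ hf, setLIntegral_const, hv3] at this
  rw [h6]
  refine (ENNReal.mul_le_mul_iff_left h0 ENNReal.ofReal_ne_top).1 (this.trans_eq ?_)
  ring

/-- Values of `R` on a square differ along horizontal and vertical segments by at most the
integral of `H` over the full chord of the square `closedBall c r`. -/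
structure ChordBound (R H : ℝ × ℝ → ENNReal) (c : ℝ × ℝ) (r : ℝ) : Prop where
  horizontal : ∀ s ∈ Set.Icc (c.1 - r) (c.1 + r), ∀ s' ∈ Set.Icc (c.1 - r) (c.1 + r),
    ∀ t, R (s, t) ≤ R (s', t) + ∫⁻ σ in Set.Icc (c.1 - r) (c.1 + r), H (σ, t)
  vertical : ∀ t ∈ Set.Icc (c.2 - r) (c.2 + r), ∀ t' ∈ Set.Icc (c.2 - r) (c.2 + r),
    ∀ s, R (s, t) ≤ R (s, t') + ∫⁻ σ in Set.Icc (c.2 - r) (c.2 + r), H (s, σ)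

theorem closedBall_eq_Icc_prod (c : ℝ × ℝ) (r : ℝ) :
    Metric.closedBall c r = Set.Icc (c.1 - r) (c.1 + r) ×ˢ Set.Icc (c.2 - r) (c.2 + r) := by
  rw [← Real.closedBall_eq_Icc, ← Real.closedBall_eq_Icc, closedBall_prod_same]

theorem setLIntegral_closedBall {f : ℝ × ℝ → ENNReal} (hf : Measurable f) (c : ℝ × ℝ) (r : ℝ) :
    ∫⁻ p in Metric.closedBall c r, f p =
      ∫⁻ s in Set.Icc (c.1 - r) (c.1 + r), ∫⁻ t in Set.Icc (c.2 - r) (c.2 + r), f (s, t) := by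
  rw [closedBall_eq_Icc_prod, Measure.volume_eq_prod, setLIntegral_prod _ hf.aemeasurable]

theorem setLIntegral_closedBall_swap {f : ℝ × ℝ → ENNReal} (hf : Measurable f) (c : ℝ × ℝ)
    (r : ℝ) : ∫⁻ p in Metric.closedBall c r, f p =
      ∫⁻ t in Set.Icc (c.2 - r) (c.2 + r), ∫⁻ s in Set.Icc (c.1 - r) (c.1 + r), f (s, t) := by
  rw [closedBall_eq_Icc_prod, Measure.volume_eq_prod, setLIntegral_prod_symm _ hf.aemeasurable]

theorem ChordBound.lintegral_sq_le {R H : ℝ × ℝ → ENNReal} {c : ℝ × ℝ} {r : ℝ}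
    (h : ChordBound R H c r) (hr : 0 < r) (hR : Measurable R) (hH : Measurable H) :
    ∫⁻ p in Metric.closedBall c r, R p ^ 2 ≤
      (ENNReal.ofReal (1 / (2 * r)) * (∫⁻ p in Metric.closedBall c r, R p) +
        ∫⁻ p in Metric.closedBall c r, H p) ^ 2 := by
  set G : ℝ × ℝ → ENNReal := fun p => ENNReal.ofReal (1 / (2 * r)) * R p + H p with hG
  have hGm : Measurable G := by fun_prop
  have aux : ∀ (f g : ℝ → ENNReal) (a : ℝ), Measurable f →
      (∀ s ∈ Set.Icc (a - r) (a + r), ∀ s' ∈ Set.Icc (a - r) (a + r),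
        f s ≤ f s' + ∫⁻ σ in Set.Icc (a - r) (a + r), g σ) →
      ∀ s ∈ Set.Icc (a - r) (a + r),
        f s ≤ ∫⁻ σ in Set.Icc (a - r) (a + r), (ENNReal.ofReal (1 / (2 * r)) * f σ + g σ) := by
    intro f g a hf hfg s hs
    have h1 := const_mul_measure_le_lintegral_add hf measurableSet_Icc
      (fun s' hs' => hfg s hs s' hs')
    have hv : volume (Set.Icc (a - r) (a + r)) = ENNReal.ofReal (2 * r) := by
      rw [Real.volume_Icc]; congr 1; ring
    have hinv : ENNReal.ofReal (1 / (2 * r)) * ENNReal.ofReal (2 * r) = 1 := by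
      rw [← ENNReal.ofReal_mul (by positivity), one_div_mul_cancel (by positivity)]; simp
    rw [lintegral_add_left (by fun_prop), lintegral_const_mul _ hf]
    rw [hv] at h1
    calc f s = ENNReal.ofReal (1 / (2 * r)) * (f s * ENNReal.ofReal (2 * r)) := by
          rw [mul_left_comm, hinv, mul_one]
      _ ≤ _ := mul_le_mul_right h1 _
      _ = _ := by rw [mul_add, mul_left_comm, hinv, mul_one]
  have hGint : ∫⁻ p in Metric.closedBall c r, G p =
      ENNReal.ofReal (1 / (2 * r)) * (∫⁻ p in Metric.closedBall c r, R p) +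
        ∫⁻ p in Metric.closedBall c r, H p := by
    rw [lintegral_add_left (by fun_prop), lintegral_const_mul _ hR]
  rw [← hGint, sq]
  nth_rewrite 1 [setLIntegral_closedBall_swap hGm]
  rw [setLIntegral_closedBall hGm, setLIntegral_closedBall (by fun_prop)]
  calc _ ≤ ∫⁻ s in Set.Icc (c.1 - r) (c.1 + r), ∫⁻ t in Set.Icc (c.2 - r) (c.2 + r),
        (∫⁻ σ in Set.Icc (c.1 - r) (c.1 + r), G (σ, t)) *
          (∫⁻ σ in Set.Icc (c.2 - r) (c.2 + r), G (s, σ)) := by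
        refine setLIntegral_mono' measurableSet_Icc fun s hs =>
          setLIntegral_mono' measurableSet_Icc fun t ht => ?_
        rw [sq]
        exact mul_le_mul'
          (aux (fun σ => R (σ, t)) (fun σ => H (σ, t)) c.1 (by fun_prop)
            (fun s hs s' hs' => h.horizontal s hs s' hs' t) s hs)
          (aux (fun σ => R (s, σ)) (fun σ => H (s, σ)) c.2 (by fun_prop)
            (fun s' hs' s'' hs'' => h.vertical s' hs' s'' hs'' s) t ht)
    _ = _ := by
        have hm : Measurable fun t => ∫⁻ σ in Set.Icc (c.1 - r) (c.1 + r), G (σ, t) :=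
          hGm.lintegral_prod_left' 
        have hm2 : Measurable fun s => ∫⁻ σ in Set.Icc (c.2 - r) (c.2 + r), G (s, σ) :=
          hGm.lintegral_prod_right'
        simp_rw [lintegral_mul_const _ hm]
        rw [lintegral_const_mul _ hm2]

theorem ChordBound.lintegral_le_middle {R H : ℝ × ℝ → ENNReal} {c : ℝ × ℝ} {r : ℝ}
    (h : ChordBound R H c (3 * r)) (hr : 0 < r) (hR : Measurable R) (hH : Measurable H) :
    ∫⁻ p in Metric.closedBall c (3 * r), R p ≤
      9 * (∫⁻ p in Metric.closedBall c r, R p) +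
        ENNReal.ofReal (24 * r) * ∫⁻ p in Metric.closedBall c (3 * r), H p := by
  have hsub : Set.Icc (c.1 - r) (c.1 + r) ⊆ Set.Icc (c.1 - 3 * r) (c.1 + 3 * r) :=
    Set.Icc_subset_Icc (by linarith) (by linarith)
  have hm : Measurable fun t => ∫⁻ σ in Set.Icc (c.1 - r) (c.1 + r), R (σ, t) :=
    hR.lintegral_prod_left'
  have hm' : Measurable fun t => ∫⁻ σ in Set.Icc (c.1 - 3 * r) (c.1 + 3 * r), H (σ, t) :=
    hH.lintegral_prod_left'
  have hm2 : Measurable fun s => ∫⁻ σ in Set.Icc (c.2 - r) (c.2 + r), R (s, σ) :=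
    hR.lintegral_prod_right'
  set E := ∫⁻ p in Metric.closedBall c (3 * r), H p with hE
  have e1 : ∫⁻ p in Metric.closedBall c (3 * r), R p ≤
      3 * (∫⁻ t in Set.Icc (c.2 - 3 * r) (c.2 + 3 * r),
          ∫⁻ σ in Set.Icc (c.1 - r) (c.1 + r), R (σ, t))
        + ENNReal.ofReal (6 * r) * E := by
    rw [hE, setLIntegral_closedBall_swap hR, setLIntegral_closedBall_swap hH,
      ← lintegral_const_mul _ hm, ← lintegral_const_mul _ hm', ← lintegral_add_left (by fun_prop)]
    exact setLIntegral_mono' measurableSet_Icc fun t _ =>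
      lintegral_le_three_mul_middle (f := fun s => R (s, t)) (by fun_prop) hr
        fun s hs s' hs' => h.horizontal s hs s' hs' t
  have e2 : ∫⁻ t in Set.Icc (c.2 - 3 * r) (c.2 + 3 * r),
        ∫⁻ σ in Set.Icc (c.1 - r) (c.1 + r), R (σ, t) ≤
      3 * (∫⁻ p in Metric.closedBall c r, R p) + ENNReal.ofReal (6 * r) * E := by
    have hm3 : Measurable fun s => ∫⁻ σ in Set.Icc (c.2 - 3 * r) (c.2 + 3 * r), H (s, σ) :=
      hH.lintegral_prod_right'
    calc _ = ∫⁻ s in Set.Icc (c.1 - r) (c.1 + r),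
          ∫⁻ t in Set.Icc (c.2 - 3 * r) (c.2 + 3 * r), R (s, t) := by
          rw [lintegral_lintegral_swap]
          exact (hR.comp measurable_swap).aemeasurable
      _ ≤ ∫⁻ s in Set.Icc (c.1 - r) (c.1 + r),
          (3 * (∫⁻ t in Set.Icc (c.2 - r) (c.2 + r), R (s, t)) +
          ENNReal.ofReal (6 * r) * ∫⁻ t in Set.Icc (c.2 - 3 * r) (c.2 + 3 * r), H (s, t)) :=
          setLIntegral_mono' measurableSet_Icc fun s _ =>
            lintegral_le_three_mul_middle (f := fun t => R (s, t)) (by fun_prop) hr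
              fun t ht t' ht' => h.vertical t ht t' ht' s
      _ ≤ _ := by
          rw [lintegral_add_left (by fun_prop), lintegral_const_mul _ hm2,
            lintegral_const_mul _ hm3, setLIntegral_closedBall hR, hE, setLIntegral_closedBall hH]
          gcongr
  have h24 : ENNReal.ofReal (24 * r) = 4 * ENNReal.ofReal (6 * r) := by
    rw [← ENNReal.ofReal_ofNat, ← ENNReal.ofReal_mul (by norm_num)]
    congr 1; ring
  calc _ ≤ _ := e1
    _ ≤ 3 * (3 * (∫⁻ p in Metric.closedBall c r, R p) + ENNReal.ofReal (6 * r) * E) +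
        ENNReal.ofReal (6 * r) * E := by gcongr
    _ = _ := by rw [h24]; ring

theorem continuous_measureReal_closedBall {E : Type*} [NormedAddCommGroup E] [NormedSpace ℝ E]
    [FiniteDimensional ℝ E] [Nontrivial E] [MeasurableSpace E] [BorelSpace E]
    (ν : Measure E) [ν.IsAddHaarMeasure] (μ : Measure E) [IsFiniteMeasure μ] (hμ : μ ≪ ν) (c : E) :
    Continuous fun r : ℝ => μ.real (Metric.closedBall c r) := by
  have h : ∀ r : ℝ, μ.real (Metric.closedBall c r) =
      ∫ p, (Metric.closedBall c r).indicator (fun _ => (1 : ℝ)) p ∂μ := fun r => by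
    rw [integral_indicator Metric.isClosed_closedBall.measurableSet]
    simp
  simp_rw [h]
  refine continuous_iff_continuousAt.2 fun r₀ => ?_
  refine continuousAt_of_dominated (bound := fun _ => 1) (Filter.Eventually.of_forall fun r =>
    (aestronglyMeasurable_const.indicator Metric.isClosed_closedBall.measurableSet))
    (Filter.Eventually.of_forall fun r => Filter.Eventually.of_forall fun p => ?_)
    (integrable_const _) ?_
  · refine (norm_indicator_le_norm_self _ _).trans ?_
    simp
  · have : ∀ᵐ p ∂μ, p ∉ Metric.sphere c r₀ := by
      rw [← measure_eq_zero_iff_ae_notMem]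
      exact hμ (Measure.addHaar_sphere ν c r₀)
    filter_upwards [this] with p hp
    rcases lt_or_gt_of_ne (show dist p c ≠ r₀ from hp) with h | h
    · refine (continuousAt_const (y := (1 : ℝ))).congr ?_
      filter_upwards [lt_mem_nhds h] with r hr
      rw [Set.indicator_of_mem (Metric.mem_closedBall.2 hr.le)]
    · refine (continuousAt_const (y := (0 : ℝ))).congr ?_
      filter_upwards [gt_mem_nhds h] with r hr
      rw [Set.indicator_of_notMem fun hh => absurd (Metric.mem_closedBall.1 hh) (not_le.2 hr)]

theorem setLIntegral_eq_lintegral_of_forall_notMem {α : Type*} [MeasurableSpace α] {μ : Measure α}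
    {f : α → ENNReal} {S : Set α} (hS : MeasurableSet S) (h : ∀ p ∉ S, f p = 0) :
    ∫⁻ p in S, f p ∂μ = ∫⁻ p, f p ∂μ := by
  rw [← lintegral_indicator hS]
  refine lintegral_congr fun p => ?_
  by_cases hp : p ∈ S
  · simp [hp]
  · simp [hp, h p hp]

theorem exists_closedBall_setLIntegral_eq {R : ℝ × ℝ → ENNReal}
    (hfin : ∫⁻ p, R p ≠ ⊤) {M : ENNReal} (hM0 : M ≠ 0) (hM : M ≤ ∫⁻ p, R p) {B : ℝ}
    (hB : ∀ p, R p ≠ 0 → ‖p‖ ≤ B) {c : ℝ × ℝ} (hc : R c ≠ 0) :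
    ∃ r, 0 < r ∧ r ≤ 2 * B ∧ ∫⁻ p in Metric.closedBall c r, R p = M := by
  set μ : Measure (ℝ × ℝ) := volume.withDensity R with hμ
  have hMfin : M ≠ ⊤ := ne_top_of_le_ne_top hfin hM
  have : IsFiniteMeasure μ := isFiniteMeasure_withDensity hfin
  have happ : ∀ r, μ (Metric.closedBall c r) = ∫⁻ p in Metric.closedBall c r, R p := fun r =>
    withDensity_apply _ Metric.isClosed_closedBall.measurableSet
  have hcont := continuous_measureReal_closedBall volume μ (withDensity_absolutelyContinuous _ _) c
  have hB0 : 0 ≤ B := (norm_nonneg c).trans (hB c hc)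
  have hbig : μ.real (Metric.closedBall c (2 * B)) = (∫⁻ p, R p).toReal := by
    rw [Measure.real, happ, setLIntegral_eq_lintegral_of_forall_notMem
      Metric.isClosed_closedBall.measurableSet]
    intro p hp
    by_contra hne
    refine hp (Metric.mem_closedBall.2 ((dist_le_norm_add_norm _ _).trans ?_))
    linarith [hB p hne, hB c hc]
  have h0 : μ.real (Metric.closedBall c 0) = 0 := by
    rw [Measure.real, Metric.closedBall_zero,
      withDensity_absolutelyContinuous _ _ (measure_singleton c)]
    simp
  have hmem : M.toReal ∈ Set.Icc (μ.real (Metric.closedBall c 0))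
      (μ.real (Metric.closedBall c (2 * B))) := by
    rw [h0, hbig]
    exact ⟨ENNReal.toReal_nonneg, ENNReal.toReal_mono hfin hM⟩
  obtain ⟨r, hr, hrM⟩ := intermediate_value_Icc (by positivity) hcont.continuousOn hmem
  have hrM' : ∫⁻ p in Metric.closedBall c r, R p = M := by
    rw [← happ, ← ENNReal.toReal_eq_toReal_iff' (measure_ne_top _ _) hMfin]
    exact hrM
  refine ⟨r, lt_of_le_of_ne hr.1 ?_, hr.2, hrM'⟩
  rintro rfl
  exact (ENNReal.toReal_pos hM0 hMfin).ne (h0.symm.trans hrM)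

theorem exists_covering_const : ∃ K : ℕ, ∀ (R σ τ : ℝ × ℝ → ENNReal) (M C : ENNReal) (B : ℝ),
    Measurable τ → ∫⁻ p, R p ≠ ⊤ → M ≠ 0 → M ≤ ∫⁻ p, R p →
    (∀ p, R p ≠ 0 → ‖p‖ ≤ B) → (∀ p, R p = 0 → σ p = 0) →
    (∀ c r, 0 < r → ∫⁻ p in Metric.closedBall c r, R p = M →
      ∫⁻ p in Metric.closedBall c r, σ p ≤ C * ∫⁻ p in Metric.closedBall c r, τ p) →
    ∫⁻ p, σ p ≤ K * (C * ∫⁻ p, τ p) := by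
  obtain ⟨K, t, ht, hK⟩ := HasBesicovitchCovering.no_satelliteConfig (α := ℝ × ℝ)
  refine ⟨K, fun R σ τ M C B hτ hfin hM0 hM hB hσ h => ?_⟩
  choose r hr0 hrB hrM using fun c : {p // R p ≠ 0} =>
    exists_closedBall_setLIntegral_eq hfin hM0 hM hB c.2
  obtain ⟨s, hs, hcov⟩ := Besicovitch.exist_disjoint_covering_families ht hK
    { c := fun c : {p // R p ≠ 0} => (c : ℝ × ℝ), r := r, rpos := hr0, r_bound := 2 * B,
      r_le := hrB }
  simp only at hs hcov
  have hcount : ∀ i, (s i).Countable := fun i =>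
    (hs i).countable_of_nonempty_interior fun j _ =>
      (Metric.nonempty_ball.2 (hr0 j)).mono Metric.ball_subset_interior_closedBall
  have hmeas : ∀ j : {p // R p ≠ 0}, MeasurableSet (Metric.closedBall (j : ℝ × ℝ) (r j)) :=
    fun j => Metric.isClosed_closedBall.measurableSet
  calc ∫⁻ p, σ p = ∫⁻ p in ⋃ i, ⋃ j ∈ s i, Metric.closedBall (j : ℝ × ℝ) (r j), σ p := by
        refine (setLIntegral_eq_lintegral_of_forall_notMem (.iUnion fun i =>
          .biUnion (hcount i) fun j _ => hmeas j) fun p hp => hσ p ?_).symm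
        by_contra hne
        refine hp (Set.mem_of_subset_of_mem ?_ (hcov ⟨⟨p, hne⟩, rfl⟩))
        exact Set.iUnion_mono fun i => Set.iUnion₂_mono fun j _ => Metric.ball_subset_closedBall
    _ ≤ ∑ i, ∫⁻ p in ⋃ j ∈ s i, Metric.closedBall (j : ℝ × ℝ) (r j), σ p := by
        exact (lintegral_iUnion_le _ _).trans_eq (tsum_fintype _)
    _ ≤ ∑ i : Fin K, C * ∫⁻ p, τ p := Finset.sum_le_sum fun i _ => ?_
    _ = K * (C * ∫⁻ p, τ p) := by simp
  have := (hcount i).to_subtype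
  calc _ ≤ ∑' j : s i, ∫⁻ p in Metric.closedBall (j : ℝ × ℝ) (r j), σ p := by
        rw [Set.biUnion_eq_iUnion]; exact lintegral_iUnion_le _ _
    _ ≤ ∑' j : s i, C * ∫⁻ p in Metric.closedBall (j : ℝ × ℝ) (r j), τ p :=
        ENNReal.tsum_le_tsum fun j => h _ _ (hr0 _) (hrM _)
    _ = C * ∫⁻ p in ⋃ j ∈ s i, Metric.closedBall (j : ℝ × ℝ) (r j), τ p := by
        rw [ENNReal.tsum_mul_left, lintegral_biUnion (hcount i) (fun j _ => hmeas j) (hs i)]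
    _ ≤ _ := mul_le_mul_right (setLIntegral_le_lintegral _ _) _

theorem ofReal_norm_sub_le_lintegral {E : Type*} [NormedAddCommGroup E] [NormedSpace ℝ E]
    {f : ℝ → E} (hf : Differentiable ℝ f) {g : ℝ → ℝ} (hg : Measurable g)
    (h : ∀ t, ‖deriv f t‖ ≤ g t) {a b : ℝ} (hab : a ≤ b) :
    ENNReal.ofReal ‖f b - f a‖ ≤ ∫⁻ t in Set.Icc a b, ENNReal.ofReal (g t) := by
  have hg0 : ∀ t, 0 ≤ g t := fun t => (norm_nonneg _).trans (h t)
  rcases eq_or_ne (∫⁻ t in Set.Icc a b, ENNReal.ofReal (g t)) ⊤ with htop | htop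
  · rw [htop]; exact le_top
  have hgi : IntegrableOn g (Set.Icc a b) :=
    (lintegral_ofReal_ne_top_iff_integrable hg.aestronglyMeasurable
      (Filter.Eventually.of_forall hg0)).1 htop
  rw [← ofReal_integral_eq_lintegral_ofReal hgi (Filter.Eventually.of_forall hg0),
    integral_Icc_eq_integral_Ioc, ← intervalIntegral.integral_of_le hab]
  refine ENNReal.ofReal_le_ofReal (norm_sub_le_integral_of_norm_deriv_le_of_le hab
    hf.continuous.continuousOn hf.differentiableOn
    (Filter.Eventually.of_forall fun t _ => h t) ?_)
  exact (intervalIntegrable_iff_integrableOn_Icc_of_le hab).2 hgi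

/-- The statistics vector potential felt by particle `j`. -/
def vecPot (α : ℝ) {N : ℕ} (j : Fin N) (x : Fin N → ℂ) : ℂ :=
  (α : ℂ) * ∑ k ∈ Finset.univ.erase j,
    Complex.I * (x j - x k) / ((‖x j - x k‖ : ℂ) ^ 2)

/-- The covariant derivative of `u` in the direction `e` of particle `j`. -/
def covD (α : ℝ) {N : ℕ} (u : (Fin N → ℂ) → ℂ) (j : Fin N) (x : Fin N → ℂ) (e : ℂ) : ℂ :=
  -Complex.I * fderiv ℝ u x (Pi.single j e) +
    (((vecPot α j x).re * e.re + (vecPot α j x).im * e.im : ℝ) : ℂ) * u x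

section covariant

variable {α : ℝ} {N : ℕ} {u : (Fin N → ℂ) → ℂ}

theorem covSq_eq (j : Fin N) (x : Fin N → ℂ) :
    covSq α u j x = ‖covD α u j x 1‖ ^ 2 + ‖covD α u j x Complex.I‖ ^ 2 := by
  simp [covSq, covD, vecPot]

theorem covSq_nonneg (j : Fin N) (x : Fin N → ℂ) : 0 ≤ covSq α u j x := by
  rw [covSq_eq]; positivity

theorem covD_eq (j : Fin N) (x : Fin N → ℂ) (e : ℂ) :
    covD α u j x e = e.re * covD α u j x 1 + e.im * covD α u j x Complex.I := by
  have h : (Pi.single j e : Fin N → ℂ) =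
      e.re • (Pi.single j 1 : Fin N → ℂ) + e.im • (Pi.single j Complex.I : Fin N → ℂ) := by
    ext k
    by_cases hk : k = j
    · subst hk; simp
    · simp [hk]
  simp only [covD, h, map_add, map_smul, Complex.real_smul, Complex.one_re, Complex.one_im,
    Complex.I_re, Complex.I_im]
  push_cast
  ring

theorem norm_covD_sq_le (j : Fin N) (x : Fin N → ℂ) (e : ℂ) :
    ‖covD α u j x e‖ ^ 2 ≤ ‖e‖ ^ 2 * covSq α u j x := by
  rw [covD_eq, covSq_eq, Complex.sq_norm e, Complex.normSq_apply]
  set p := ‖covD α u j x 1‖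
  set q := ‖covD α u j x Complex.I‖
  have h : ‖(e.re : ℂ) * covD α u j x 1 + e.im * covD α u j x Complex.I‖ ≤
      |e.re| * p + |e.im| * q := by
    refine (norm_add_le _ _).trans ?_
    simp [p, q]
  calc _ ≤ (|e.re| * p + |e.im| * q) ^ 2 := by gcongr
    _ ≤ (|e.re| ^ 2 + |e.im| ^ 2) * (p ^ 2 + q ^ 2) := by
        nlinarith [sq_nonneg (|e.re| * q - |e.im| * p)]
    _ = _ := by rw [sq_abs, sq_abs]; ring

theorem measurable_vecPot (j : Fin N) : Measurable (vecPot α j : (Fin N → ℂ) → ℂ) := by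
  unfold vecPot
  fun_prop

theorem measurable_covD (hu : ContDiff ℝ (⊤ : ℕ∞) u) (j : Fin N) (e : ℂ) :
    Measurable (fun x => covD α u j x e) := by
  have h1 : Measurable (fun x => fderiv ℝ u x (Pi.single j e)) :=
    ((hu.continuous_fderiv (by simp)).clm_apply continuous_const).measurable
  have h2 := measurable_vecPot (α := α) j
  have h3 := hu.continuous.measurable
  unfold covD
  fun_prop

theorem measurable_covSq (hu : ContDiff ℝ (⊤ : ℕ∞) u) (j : Fin N) :
    Measurable (covSq α u j) := by
  have h1 := measurable_covD (α := α) hu j 1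
  have h2 := measurable_covD (α := α) hu j Complex.I
  have : covSq α u j = fun x => ‖covD α u j x 1‖ ^ 2 + ‖covD α u j x Complex.I‖ ^ 2 :=
    funext (covSq_eq j)
  rw [this]
  fun_prop

theorem hasDerivAt_comp_line (hu : ContDiff ℝ (⊤ : ℕ∞) u) (x v : Fin N → ℂ) (t : ℝ) :
    HasDerivAt (fun s : ℝ => u (x + s • v)) (fderiv ℝ u (x + t • v) v) t := by
  have h1 : HasDerivAt (fun s : ℝ => x + s • v) v t := by
    simpa using ((hasDerivAt_id t).smul_const v).const_add x
  exact ((hu.differentiable (by simp)) _).hasFDerivAt.comp_hasDerivAt t h1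

/-- The diamagnetic bound for the derivative of `‖u‖ ^ 2` along a line. -/
theorem abs_deriv_normSq_le (hu : ContDiff ℝ (⊤ : ℕ∞) u) (j : Fin N) (x : Fin N → ℂ) {e : ℂ}
    (he : ‖e‖ = 1) {c : ℝ} (hc : 0 < c) (t : ℝ) :
    ‖deriv (fun s : ℝ => ‖u (x + s • (Pi.single j e : Fin N → ℂ))‖ ^ 2) t‖ ≤
      c * ‖u (x + t • (Pi.single j e : Fin N → ℂ))‖ ^ 2 +
        c⁻¹ * covSq α u j (x + t • (Pi.single j e : Fin N → ℂ)) := by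
  rw [((hasDerivAt_comp_line hu x (Pi.single j e) t).norm_sq).deriv]
  set y := x + t • (Pi.single j e : Fin N → ℂ)
  have h1 : (inner ℝ (u y) (fderiv ℝ u y (Pi.single j e)) : ℝ) =
      inner ℝ (u y) (Complex.I * covD α u j y e) := by
    have : Complex.I * covD α u j y e = fderiv ℝ u y (Pi.single j e) +
        (((vecPot α j y).re * e.re + (vecPot α j y).im * e.im : ℝ) : ℂ) * (Complex.I * u y) := by
      unfold covD
      linear_combination (-fderiv ℝ u y (Pi.single j e)) * Complex.I_mul_I
    rw [this, inner_add_right]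
    simp [Complex.inner]
    ring
  rw [h1]
  have h2 := abs_real_inner_le_norm (u y) (Complex.I * covD α u j y e)
  have h3 := norm_covD_sq_le (α := α) (u := u) j y e
  rw [norm_mul, Complex.norm_I, one_mul] at h2
  rw [he, one_pow, one_mul] at h3
  rw [Real.norm_eq_abs, abs_mul, abs_two]
  have h4 : c⁻¹ * ‖covD α u j y e‖ ^ 2 ≤ c⁻¹ * covSq α u j y := by gcongr
  have h5 : 2 * (‖u y‖ * ‖covD α u j y e‖) ≤
      c * ‖u y‖ ^ 2 + c⁻¹ * ‖covD α u j y e‖ ^ 2 := by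
    have := sq_nonneg (c * ‖u y‖ - ‖covD α u j y e‖)
    have h6 : c * ‖u y‖ ^ 2 + c⁻¹ * ‖covD α u j y e‖ ^ 2 - 2 * (‖u y‖ * ‖covD α u j y e‖) =
      c⁻¹ * (c * ‖u y‖ - ‖covD α u j y e‖) ^ 2 := by field_simp; ring
    have h7 : 0 ≤ c⁻¹ * (c * ‖u y‖ - ‖covD α u j y e‖) ^ 2 := by positivity
    linarith
  linarith

end covariant

theorem marginal_le_add_lintegral {N : ℕ} {G F : Fin N → (Fin N → ℂ) → ENNReal}
    (hG : ∀ j, Measurable (G j)) (hF : ∀ j, Measurable (F j)) {φ : ℝ → ℝ × ℝ} (hφ : Measurable φ)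
    {s s' : ℝ} {I : Set ℝ}
    (h : ∀ j z, G j (insertAt j (Complex.measurableEquivRealProd.symm (φ s)) z) ≤
      G j (insertAt j (Complex.measurableEquivRealProd.symm (φ s')) z) +
        ∫⁻ σ in I, F j (insertAt j (Complex.measurableEquivRealProd.symm (φ σ)) z)) :
    marginal G (φ s) ≤ marginal G (φ s') + ∫⁻ σ in I, marginal F (φ σ) := by
  have hm : ∀ j, Measurable fun q : ℝ × ({k : Fin N // k ≠ j} → ℂ) =>
      F j (insertAt j (Complex.measurableEquivRealProd.symm (φ q.1)) q.2) := fun j =>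
    (measurable_insertAt_left j (hF j)).comp ((hφ.comp measurable_fst).prodMk measurable_snd)
  simp only [marginal]
  rw [lintegral_finsetSum, ← Finset.sum_add_distrib]
  · refine Finset.sum_le_sum fun j _ => ?_
    rw [lintegral_lintegral_swap (hm j).aemeasurable, ← lintegral_add_left]
    · exact lintegral_mono fun z => h j z
    · exact (measurable_insertAt_left j (hG j)).comp measurable_prodMk_left
  · exact fun j _ => (hm j).lintegral_prod_right'

theorem marginal_add_const_mul {N : ℕ} {G F : Fin N → (Fin N → ℂ) → ENNReal}
    (hG : ∀ j, Measurable (G j)) (hF : ∀ j, Measurable (F j)) (a b : ENNReal) (p : ℝ × ℝ) :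
    marginal (fun j x => a * G j x + b * F j x) p = a * marginal G p + b * marginal F p := by
  have hm : ∀ j, Measurable fun z =>
      G j (insertAt j (Complex.measurableEquivRealProd.symm p) z) := fun j =>
    (measurable_insertAt_left j (hG j)).comp measurable_prodMk_left
  have hm' : ∀ j, Measurable fun z =>
      F j (insertAt j (Complex.measurableEquivRealProd.symm p) z) := fun j =>
    (measurable_insertAt_left j (hF j)).comp measurable_prodMk_left
  simp only [marginal]
  rw [Finset.mul_sum, Finset.mul_sum, ← Finset.sum_add_distrib]
  refine Finset.sum_congr rfl fun j _ => ?_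
  rw [lintegral_add_left ((hm j).const_mul a), lintegral_const_mul _ (hm j),
    lintegral_const_mul _ (hm' j)]

/-- The one-particle density of `u`, in real coordinates and with values in `[0, ∞]`. -/
def massMarginal {N : ℕ} (u : (Fin N → ℂ) → ℂ) : ℝ × ℝ → ENNReal :=
  marginal fun _ x => ENNReal.ofReal (‖u x‖ ^ 2)

/-- The kinetic energy density of `u`, in real coordinates and with values in `[0, ∞]`. -/
def energyMarginal (α : ℝ) {N : ℕ} (u : (Fin N → ℂ) → ℂ) : ℝ × ℝ → ENNReal :=
  marginal fun j x => ENNReal.ofReal (covSq α u j x)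

section covariant

variable {α : ℝ} {N : ℕ} {u : (Fin N → ℂ) → ℂ}

theorem measurable_ofReal_normSq (hu : ContDiff ℝ (⊤ : ℕ∞) u) :
    Measurable fun x => ENNReal.ofReal (‖u x‖ ^ 2) := by
  have := hu.continuous.measurable
  fun_prop

theorem measurable_massMarginal (hu : ContDiff ℝ (⊤ : ℕ∞) u) : Measurable (massMarginal u) :=
  measurable_marginal fun _ => measurable_ofReal_normSq hu

theorem measurable_energyMarginal (hu : ContDiff ℝ (⊤ : ℕ∞) u) :
    Measurable (energyMarginal α u) :=
  measurable_marginal fun j => (measurable_covSq hu j).ennreal_ofReal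

theorem ofReal_normSq_line_le (hu : ContDiff ℝ (⊤ : ℕ∞) u) (j : Fin N) (x : Fin N → ℂ) {e : ℂ}
    (he : ‖e‖ = 1) {c : ℝ} (hc : 0 < c) {a b s s' : ℝ} (hs : s ∈ Set.Icc a b)
    (hs' : s' ∈ Set.Icc a b) :
    ENNReal.ofReal (‖u (x + s • (Pi.single j e : Fin N → ℂ))‖ ^ 2) ≤
      ENNReal.ofReal (‖u (x + s' • (Pi.single j e : Fin N → ℂ))‖ ^ 2) +
      ∫⁻ t in Set.Icc a b,
        (ENNReal.ofReal c * ENNReal.ofReal (‖u (x + t • (Pi.single j e : Fin N → ℂ))‖ ^ 2) +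
        ENNReal.ofReal c⁻¹ * ENNReal.ofReal (covSq α u j (x + t • (Pi.single j e : Fin N → ℂ)))) := by
  set v : Fin N → ℂ := Pi.single j e
  have hline : Continuous fun t : ℝ => x + t • v := by fun_prop
  have hd : Differentiable ℝ fun t : ℝ => ‖u (x + t • v)‖ ^ 2 := fun t =>
    (hasDerivAt_comp_line hu x v t).norm_sq.differentiableAt
  have hg : Measurable fun t : ℝ => c * ‖u (x + t • v)‖ ^ 2 + c⁻¹ * covSq α u j (x + t • v) := by
    have h1 : Measurable fun t : ℝ => ‖u (x + t • v)‖ :=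
      (hu.continuous.comp hline).norm.measurable
    have h2 : Measurable fun t : ℝ => covSq α u j (x + t • v) :=
      (measurable_covSq hu j).comp hline.measurable
    fun_prop
  have key : ∀ p ∈ Set.Icc a b, ∀ q ∈ Set.Icc a b, p ≤ q →
      ENNReal.ofReal |‖u (x + q • v)‖ ^ 2 - ‖u (x + p • v)‖ ^ 2| ≤
      ∫⁻ t in Set.Icc a b, (ENNReal.ofReal c * ENNReal.ofReal (‖u (x + t • v)‖ ^ 2) +
        ENNReal.ofReal c⁻¹ * ENNReal.ofReal (covSq α u j (x + t • v))) := by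
    intro p hp q hq hpq
    refine (ofReal_norm_sub_le_lintegral hd hg
      (fun t => abs_deriv_normSq_le (α := α) hu j x he hc t) hpq).trans ?_
    refine (lintegral_mono_set (Set.Icc_subset_Icc hp.1 hq.2)).trans_eq
      (lintegral_congr fun t => ?_)
    have := covSq_nonneg (α := α) (u := u) j (x + t • v)
    rw [ENNReal.ofReal_add (by positivity) (by positivity), ENNReal.ofReal_mul hc.le,
      ENNReal.ofReal_mul (by positivity)]
  have hle : ENNReal.ofReal (‖u (x + s • v)‖ ^ 2) ≤ ENNReal.ofReal (‖u (x + s' • v)‖ ^ 2) +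
      ENNReal.ofReal |‖u (x + s • v)‖ ^ 2 - ‖u (x + s' • v)‖ ^ 2| := by
    rw [← ENNReal.ofReal_add (by positivity) (abs_nonneg _)]
    refine ENNReal.ofReal_le_ofReal ?_
    linarith [le_abs_self (‖u (x + s • v)‖ ^ 2 - ‖u (x + s' • v)‖ ^ 2)]
  refine hle.trans (add_le_add le_rfl ?_)
  rcases le_total s' s with h | h
  · exact key s' hs' s hs h
  · rw [abs_sub_comm]; exact key s hs s' hs' h

theorem chordBound_massMarginal (hu : ContDiff ℝ (⊤ : ℕ∞) u) {l : ℝ} (hl : 0 < l)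
    (c : ℝ × ℝ) (r : ℝ) :
    ChordBound (massMarginal u) (fun p => ENNReal.ofReal l * massMarginal u p +
      ENNReal.ofReal l⁻¹ * energyMarginal α u p) c r := by
  have hG : ∀ j : Fin N, Measurable fun x => ENNReal.ofReal (‖u x‖ ^ 2) := fun _ =>
    measurable_ofReal_normSq hu
  have hF : ∀ j : Fin N, Measurable fun x => ENNReal.ofReal (covSq α u j x) := fun j =>
    (measurable_covSq hu j).ennreal_ofReal
  have hH : ∀ p, ENNReal.ofReal l * massMarginal u p + ENNReal.ofReal l⁻¹ * energyMarginal α u p =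
      marginal (fun j x => ENNReal.ofReal l * ENNReal.ofReal (‖u x‖ ^ 2) +
        ENNReal.ofReal l⁻¹ * ENNReal.ofReal (covSq α u j x)) p := fun p =>
    (marginal_add_const_mul hG hF _ _ p).symm
  have hHm : ∀ j : Fin N, Measurable fun x => ENNReal.ofReal l * ENNReal.ofReal (‖u x‖ ^ 2) +
        ENNReal.ofReal l⁻¹ * ENNReal.ofReal (covSq α u j x) := fun j =>
    ((hG j).const_mul _).add ((hF j).const_mul _)
  simp only [hH]
  have hsymm1 : ∀ s t : ℝ, Complex.measurableEquivRealProd.symm (s, t) =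
      Complex.I * t + s • (1 : ℂ) := fun s t => by
    apply Complex.ext <;> simp [Complex.measurableEquivRealProd]
  have hsymm2 : ∀ s t : ℝ, Complex.measurableEquivRealProd.symm (s, t) =
      (s : ℂ) + t • Complex.I := fun s t => by
    apply Complex.ext <;> simp [Complex.measurableEquivRealProd]
  refine ⟨fun s hs s' hs' t => ?_, fun t ht t' hq s => ?_⟩
  · refine marginal_le_add_lintegral (φ := fun σ => (σ, t)) hG hHm (by fun_prop) fun j z => ?_
    simp only [hsymm1, insertAt_add_smul]
    exact ofReal_normSq_line_le hu j _ norm_one hl hs hs'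
  · refine marginal_le_add_lintegral (φ := fun σ => (s, σ)) hG hHm (by fun_prop) fun j z => ?_
    simp only [hsymm2, insertAt_add_smul]
    exact ofReal_normSq_line_le hu j _ Complex.norm_I hl ht hq

/-- The local uncertainty principle. -/
theorem lintegral_massMarginal_sq_le (hu : ContDiff ℝ (⊤ : ℕ∞) u) {c : ℝ × ℝ} {r : ℝ} (hr : 0 < r)
    {m E : ℝ} (hm : 0 ≤ m) (hE0 : 0 ≤ E)
    (hM : ∫⁻ p in Metric.closedBall c r, massMarginal u p = ENNReal.ofReal m)
    (hE : ∫⁻ p in Metric.closedBall c r, energyMarginal α u p = ENNReal.ofReal E) :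
    ∫⁻ p in Metric.closedBall c r, massMarginal u p ^ 2 ≤
      ENNReal.ofReal ((2 * m + 1) ^ 2 * (E + 1 / r ^ 2)) := by
  have hpos : 0 < E + 1 / r ^ 2 := by positivity
  set l := √(E + 1 / r ^ 2) with hl
  have hl0 : 0 < l := Real.sqrt_pos.2 hpos
  have hl2 : l ^ 2 = E + 1 / r ^ 2 := Real.sq_sqrt hpos.le
  have hRm := measurable_massMarginal hu
  have hτm := measurable_energyMarginal (α := α) hu
  refine ((chordBound_massMarginal (α := α) hu hl0 c r).lintegral_sq_le hr hRm
    (by fun_prop)).trans ?_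
  rw [lintegral_add_left (by fun_prop), lintegral_const_mul _ hRm, lintegral_const_mul _ hτm,
    hM, hE, ← ENNReal.ofReal_mul (by positivity), ← ENNReal.ofReal_mul (by positivity),
    ← ENNReal.ofReal_mul (by positivity), ← ENNReal.ofReal_add (by positivity) (by positivity),
    ← ENNReal.ofReal_add (by positivity) (by positivity), ← ENNReal.ofReal_pow (by positivity)]
  refine ENNReal.ofReal_le_ofReal ?_
  have h1 : 1 / r ≤ l := Real.le_sqrt_of_sq_le (by rw [div_pow, one_pow]; linarith)
  have h2 : l⁻¹ * E ≤ l := by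
    rw [inv_mul_le_iff₀ hl0, ← sq, hl2]
    have : 0 ≤ 1 / r ^ 2 := by positivity
    linarith
  have h3 : 1 / (2 * r) * m ≤ l * m := by
    gcongr
    calc 1 / (2 * r) ≤ 1 / r := by gcongr; linarith
      _ ≤ l := h1
  rw [← hl2, ← mul_pow]
  gcongr
  linarith

/-- Most of the mass of a square lies in its middle, unless the energy is large. -/
theorem massMarginal_le_middle (hu : ContDiff ℝ (⊤ : ℕ∞) u) {c : ℝ × ℝ} {r : ℝ} (hr : 0 < r)
    {m m₀ E : ℝ} (hm : 0 ≤ m) (hm₀ : 0 ≤ m₀) (hE0 : 0 ≤ E)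
    (hM : ∫⁻ p in Metric.closedBall c (3 * r), massMarginal u p = ENNReal.ofReal m)
    (hM₀ : ∫⁻ p in Metric.closedBall c r, massMarginal u p = ENNReal.ofReal m₀)
    (hE : ∫⁻ p in Metric.closedBall c (3 * r), energyMarginal α u p = ENNReal.ofReal E) :
    m ≤ 9 * m₀ + m / 4 + 2304 * r ^ 2 * E := by
  have hRm := measurable_massMarginal hu
  have hτm := measurable_energyMarginal (α := α) hu
  have hl : 0 < 1 / (96 * r) := by positivity
  have h := (chordBound_massMarginal (α := α) hu hl c (3 * r)).lintegral_le_middle hr hRm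
    (by fun_prop)
  rw [lintegral_add_left (by fun_prop), lintegral_const_mul _ hRm, lintegral_const_mul _ hτm,
    hM, hE, hM₀, ← ENNReal.ofReal_ofNat, ← ENNReal.ofReal_mul (by positivity),
    ← ENNReal.ofReal_mul (by positivity), ← ENNReal.ofReal_mul (by positivity),
    ← ENNReal.ofReal_add (by positivity) (by positivity),
    ← ENNReal.ofReal_mul (by positivity), ← ENNReal.ofReal_add (by positivity) (by positivity),
    ENNReal.ofReal_le_ofReal_iff (by positivity)] at h
  refine h.trans_eq ?_
  field_simp
  ring

end covariant

/-- The linear map multiplying by `c` the relative coordinate of particles `j` and `k`,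
with their center of mass and the other particles fixed. -/
def pairRotation {N : ℕ} (j k : Fin N) (c : ℂ) : (Fin N → ℂ) →ₗ[ℝ] (Fin N → ℂ) where
  toFun x i := if i = j then (x j + x k) / 2 + c * ((x j - x k) / 2)
    else if i = k then (x j + x k) / 2 - c * ((x j - x k) / 2) else x i
  map_add' x y := by
    ext i
    simp only [Pi.add_apply]
    split_ifs <;> ring
  map_smul' a x := by
    ext i
    simp only [Pi.smul_apply, Complex.real_smul, RingHom.id_apply]
    split_ifs <;> ring

section pairRotation

variable {N : ℕ} {j k : Fin N}

theorem pairRotation_left (c : ℂ) (x : Fin N → ℂ) :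
    pairRotation j k c x j = (x j + x k) / 2 + c * ((x j - x k) / 2) := by
  simp [pairRotation]

theorem pairRotation_right (hjk : j ≠ k) (c : ℂ) (x : Fin N → ℂ) :
    pairRotation j k c x k = (x j + x k) / 2 - c * ((x j - x k) / 2) := by
  simp [pairRotation, hjk.symm]

theorem pairRotation_other {l : Fin N} (hlj : l ≠ j) (hlk : l ≠ k) (c : ℂ) (x : Fin N → ℂ) :
    pairRotation j k c x l = x l := by
  simp [pairRotation, hlj, hlk]

theorem pairRotation_sub (hjk : j ≠ k) (c : ℂ) (x : Fin N → ℂ) :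
    pairRotation j k c x j - pairRotation j k c x k = c * (x j - x k) := by
  rw [pairRotation_left, pairRotation_right hjk]; ring

theorem pairRotation_add (hjk : j ≠ k) (c : ℂ) (x : Fin N → ℂ) :
    pairRotation j k c x j + pairRotation j k c x k = x j + x k := by
  rw [pairRotation_left, pairRotation_right hjk]; ring

theorem pairRotation_one (x : Fin N → ℂ) : pairRotation j k 1 x = x := by
  ext i
  by_cases hj : i = j
  · subst hj; rw [pairRotation_left]; ring
  by_cases hk : i = k
  · subst hk; rw [pairRotation_right (Ne.symm hj)]; ring
  · exact pairRotation_other hj hk _ _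

theorem pairRotation_comp (hjk : j ≠ k) (c d : ℂ) :
    pairRotation j k c ∘ₗ pairRotation j k d = pairRotation j k (c * d) := by
  refine LinearMap.ext fun x => funext fun i => ?_
  rw [LinearMap.comp_apply]
  by_cases hj : i = j
  · subst hj
    rw [pairRotation_left, pairRotation_sub hjk, pairRotation_add hjk, pairRotation_left]; ring
  by_cases hk : i = k
  · subst hk
    rw [pairRotation_right hjk, pairRotation_sub hjk, pairRotation_add hjk,
      pairRotation_right hjk]; ring
  · simp only [pairRotation_other hj hk]

theorem pairRotation_neg (hjk : j ≠ k) (c : ℂ) (x : Fin N → ℂ) :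
    pairRotation j k (-c) x = pairRotation j k c x ∘ Equiv.swap j k := by
  ext i
  by_cases hj : i = j
  · subst hj
    rw [Function.comp_apply, Equiv.swap_apply_left, pairRotation_left, pairRotation_right hjk]; ring
  by_cases hk : i = k
  · subst hk
    rw [Function.comp_apply, Equiv.swap_apply_right, pairRotation_left, pairRotation_right hjk]
    ring
  · rw [Function.comp_apply, Equiv.swap_apply_of_ne_of_ne hj hk, pairRotation_other hj hk,
      pairRotation_other hj hk]

theorem abs_det_pairRotation (hjk : j ≠ k) {c : ℂ} (hc : ‖c‖ = 1) :
    |LinearMap.det (pairRotation j k c)| = 1 := by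
  let e : (Fin N → ℂ) ≃ₗ[ℝ] (Fin N → ℂ) :=
    LinearEquiv.piCongrRight fun _ => Complex.conjLIE.toLinearEquiv
  have h1 : pairRotation j k (starRingEnd ℂ c) =
      (e : (Fin N → ℂ) →ₗ[ℝ] (Fin N → ℂ)) ∘ₗ pairRotation j k c ∘ₗ
        (e.symm : (Fin N → ℂ) →ₗ[ℝ] (Fin N → ℂ)) := by
    refine LinearMap.ext fun x => funext fun i => ?_
    simp only [LinearMap.comp_apply, LinearEquiv.coe_coe, e, LinearEquiv.piCongrRight_apply,
      LinearEquiv.piCongrRight_symm]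
    simp [pairRotation, apply_ite (starRingEnd ℂ), Complex.conj_ofNat]
  have h2 : LinearMap.det (pairRotation j k (starRingEnd ℂ c)) =
      LinearMap.det (pairRotation j k c) := by
    rw [h1, LinearMap.det_conj]
  have h3 : LinearMap.det (pairRotation j k c) * LinearMap.det (pairRotation j k c) = 1 := by
    nth_rewrite 2 [← h2]
    rw [← LinearMap.det_comp, pairRotation_comp hjk, Complex.mul_conj, Complex.normSq_eq_norm_sq,
      hc]
    have : pairRotation j k ((((1 : ℝ) ^ 2 : ℝ) : ℂ)) = LinearMap.id :=
      LinearMap.ext fun x => by simpa using pairRotation_one x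
    rw [this, LinearMap.det_id]
  rcases mul_self_eq_one_iff.1 h3 with h | h <;> simp [h]

theorem measurePreserving_pairRotation (hjk : j ≠ k) {c : ℂ} (hc : ‖c‖ = 1) :
    MeasurePreserving (pairRotation j k c) := by
  have h := abs_det_pairRotation hjk hc
  have h0 : LinearMap.det (pairRotation j k c) ≠ 0 := fun h0 => by simp [h0] at h
  refine ⟨(pairRotation j k c).continuous_of_finiteDimensional.measurable, ?_⟩
  rw [Measure.map_linearMap_addHaar_eq_smul_addHaar _ h0, abs_inv, h]
  simp

theorem continuous_pairRotation_exp :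
    Continuous fun p : (Fin N → ℂ) × ℝ => pairRotation j k (Complex.exp (p.2 * Complex.I)) p.1 := by
  refine continuous_pi fun i => ?_
  by_cases hj : i = j
  · subst hj; simp only [pairRotation_left]; fun_prop
  by_cases hk : i = k
  · subst hk; simp only [pairRotation_right (Ne.symm hj)]; fun_prop
  · simp only [pairRotation_other hj hk]; fun_prop

theorem hasDerivAt_pairRotation_exp (hjk : j ≠ k) (x : Fin N → ℂ) (θ : ℝ) :
    HasDerivAt (fun t : ℝ => pairRotation j k (Complex.exp (t * Complex.I)) x)
      (Pi.single j (Complex.I * (Complex.exp (θ * Complex.I) * ((x j - x k) / 2))) -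
        Pi.single k (Complex.I * (Complex.exp (θ * Complex.I) * ((x j - x k) / 2)))) θ := by
  have h : HasDerivAt (fun t : ℝ => Complex.exp (t * Complex.I) * ((x j - x k) / 2))
      (Complex.I * (Complex.exp (θ * Complex.I) * ((x j - x k) / 2))) θ := by
    have h1 : HasDerivAt (fun t : ℝ => (t : ℂ) * Complex.I) (1 * Complex.I) θ :=
      Complex.ofRealCLM.hasDerivAt.mul_const Complex.I
    refine (h1.cexp.mul_const ((x j - x k) / 2)).congr_deriv ?_
    ring
  refine hasDerivAt_pi.2 fun i => ?_
  by_cases hj : i = j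
  · subst hj
    simpa only [pairRotation_left, Pi.sub_apply, Pi.single_eq_same, Pi.single_eq_of_ne hjk,
      sub_zero] using h.const_add _
  by_cases hk : i = k
  · subst hk
    simpa only [pairRotation_right hjk, Pi.sub_apply, Pi.single_eq_same, Pi.single_eq_of_ne hj,
      zero_sub] using h.const_sub _
  · simpa only [pairRotation_other hj hk, Pi.sub_apply, Pi.single_eq_of_ne hj,
      Pi.single_eq_of_ne hk, sub_zero] using hasDerivAt_const θ (x i)

end pairRotation

section phase

/-- The phase `z / |z|` of a complex number. -/
def unitPhase (z : ℂ) : ℂ := z / ‖z‖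

theorem norm_unitPhase {z : ℂ} (hz : z ≠ 0) : ‖unitPhase z‖ = 1 := by
  simp [unitPhase, hz]

theorem unitPhase_ne_zero {z : ℂ} (hz : z ≠ 0) : unitPhase z ≠ 0 := by
  simp [unitPhase, hz]

theorem unitPhase_neg (z : ℂ) : unitPhase (-z) = -unitPhase z := by
  simp [unitPhase, neg_div]

theorem hasDerivAt_unitPhase {z : ℝ → ℂ} {z' : ℂ} {t : ℝ} (h : HasDerivAt z z' t) (h0 : z t ≠ 0) :
    HasDerivAt (fun s => unitPhase (z s)) (Complex.I * (z' / z t).im * unitPhase (z t)) t := by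
  have hn : (‖z t‖ : ℝ) ≠ 0 := norm_ne_zero_iff.2 h0
  have hn' : (‖z t‖ : ℂ) ≠ 0 := Complex.ofReal_ne_zero.2 hn
  have h1 : HasDerivAt (fun s => ‖z s‖) (‖z t‖ * (z' / z t).re) t := by
    have h2 := h.norm_sq.sqrt (by positivity)
    simp only [Real.sqrt_sq (norm_nonneg _)] at h2
    refine h2.congr_deriv ?_
    rw [Complex.div_re, Complex.normSq_eq_norm_sq, Complex.inner]
    simp
    field_simp
  refine (h.div h1.ofReal_comp hn').congr_deriv ?_
  have h3 : Complex.I * ((z' / z t).im : ℂ) = z' / z t - (z' / z t).re := by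
    nth_rewrite 2 [← Complex.re_add_im (z' / z t)]
    ring
  rw [h3, unitPhase]
  push_cast
  field_simp

theorem hasDerivAt_zpow_of_log {f : ℝ → ℂ} {a : ℂ} {t : ℝ} (h : HasDerivAt f (a * f t) t)
    (h0 : f t ≠ 0) (m : ℤ) : HasDerivAt (fun s => f s ^ m) (m * a * f t ^ m) t := by
  refine ((hasDerivAt_zpow m (f t) (Or.inl h0)).comp t h).congr_deriv ?_
  rw [zpow_sub_one₀ h0]
  field_simp

theorem hasDerivAt_prod_of_log {ι : Type*} [DecidableEq ι] (s : Finset ι) {f : ι → ℝ → ℂ}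
    {a : ι → ℂ} {t : ℝ} (h : ∀ i ∈ s, HasDerivAt (f i) (a i * f i t) t) :
    HasDerivAt (fun r => ∏ i ∈ s, f i r) ((∑ i ∈ s, a i) * ∏ i ∈ s, f i t) t := by
  induction s using Finset.induction_on with
  | empty => simpa using hasDerivAt_const t (1 : ℂ)
  | insert i s hi ih =>
    simp only [Finset.prod_insert hi, Finset.sum_insert hi]
    refine ((h i (Finset.mem_insert_self i s)).fun_mul
      (ih fun l hl => h l (Finset.mem_insert_of_mem hl))).congr_deriv ?_
    ring

end phase

/-- The phase accumulated when particles `j` and `k` are rotated about each other. -/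
def pairPhase (m : ℤ) {N : ℕ} (j k : Fin N) (x : Fin N → ℂ) : ℂ :=
  unitPhase (x j - x k) ^ m *
    ∏ l ∈ (Finset.univ.erase j).erase k, (unitPhase (x j - x l) * unitPhase (x k - x l)) ^ m

/-- The logarithmic rate of change of `pairPhase` when particles `j` and `k` move in the
directions `e` and `-e`. -/
def pairRate {N : ℕ} (j k : Fin N) (x : Fin N → ℂ) (e : ℂ) : ℝ :=
  2 * (e / (x j - x k)).im +
    ∑ l ∈ (Finset.univ.erase j).erase k, ((e / (x j - x l)).im - (e / (x k - x l)).im)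

section pairPhase

variable {N : ℕ} {j k : Fin N}

theorem norm_pairPhase (m : ℤ) (hjk : j ≠ k) {x : Fin N → ℂ}
    (hx : ∀ a b : Fin N, a ≠ b → x a ≠ x b) : ‖pairPhase m j k x‖ = 1 := by
  rw [pairPhase, norm_mul, norm_zpow, norm_unitPhase (sub_ne_zero.2 (hx _ _ hjk)), norm_prod,
    one_zpow, one_mul]
  refine Finset.prod_eq_one fun l hl => ?_
  simp only [Finset.mem_erase, Finset.mem_univ, and_true] at hl
  rw [norm_zpow, norm_mul, norm_unitPhase (sub_ne_zero.2 (hx _ _ (Ne.symm hl.2))),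
    norm_unitPhase (sub_ne_zero.2 (hx _ _ (Ne.symm hl.1)))]
  simp

theorem pairPhase_swap {m : ℤ} (hm : Odd m) (x : Fin N → ℂ) :
    pairPhase m j k (x ∘ Equiv.swap j k) = -pairPhase m j k x := by
  simp only [pairPhase, Function.comp_apply, Equiv.swap_apply_left, Equiv.swap_apply_right]
  rw [← neg_sub (x j) (x k), unitPhase_neg, hm.neg_zpow, neg_mul]
  congr 2
  refine Finset.prod_congr rfl fun l hl => ?_
  simp only [Finset.mem_erase, Finset.mem_univ, and_true] at hl
  rw [Equiv.swap_apply_of_ne_of_ne hl.2 hl.1, mul_comm]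

theorem hasDerivAt_pairPhase (m : ℤ) (hjk : j ≠ k) {γ : ℝ → Fin N → ℂ} {e : ℂ} {t : ℝ}
    (hγ : HasDerivAt γ (Pi.single j e - Pi.single k e) t)
    (hx : ∀ a b : Fin N, a ≠ b → γ t a ≠ γ t b) :
    HasDerivAt (fun s => pairPhase m j k (γ s))
      (m * (Complex.I * pairRate j k (γ t) e) * pairPhase m j k (γ t)) t := by
  have hi := hasDerivAt_pi.1 hγ
  have hj : HasDerivAt (fun s => γ s j) e t := by simpa [hjk] using hi j
  have hk : HasDerivAt (fun s => γ s k) (-e) t := by simpa [hjk.symm] using hi k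
  have hl : ∀ l, l ≠ j → l ≠ k → HasDerivAt (fun s => γ s l) 0 t := fun l h1 h2 => by
    simpa [h1, h2] using hi l
  have h1 := hasDerivAt_zpow_of_log
    (hasDerivAt_unitPhase (hj.fun_sub hk) (sub_ne_zero.2 (hx _ _ hjk)))
    (unitPhase_ne_zero (sub_ne_zero.2 (hx _ _ hjk))) m
  have h2 := hasDerivAt_prod_of_log ((Finset.univ.erase j).erase k)
    (f := fun l s => (unitPhase (γ s j - γ s l) * unitPhase (γ s k - γ s l)) ^ m)
    (a := fun l => m * (Complex.I *
      (((e / (γ t j - γ t l)).im - (e / (γ t k - γ t l)).im : ℝ) : ℂ))) (t := t) (by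
      intro l hl'
      simp only [Finset.mem_erase, Finset.mem_univ, and_true] at hl'
      have hjl := sub_ne_zero.2 (hx _ _ (Ne.symm hl'.2))
      have hkl := sub_ne_zero.2 (hx _ _ (Ne.symm hl'.1))
      have h3 := hasDerivAt_unitPhase (hj.fun_sub (hl l hl'.2 hl'.1)) hjl
      have h4 := hasDerivAt_unitPhase (hk.fun_sub (hl l hl'.2 hl'.1)) hkl
      refine hasDerivAt_zpow_of_log ((h3.fun_mul h4).congr_deriv ?_)
        (mul_ne_zero (unitPhase_ne_zero hjl) (unitPhase_ne_zero hkl)) m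
      simp only [sub_zero, neg_div, Complex.neg_im]
      push_cast
      ring)
  refine (h1.fun_mul h2).congr_deriv ?_
  have h5 : ((e - -e) / (γ t j - γ t k)).im = 2 * (e / (γ t j - γ t k)).im := by
    rw [sub_neg_eq_add, add_div, Complex.add_im, two_mul]
  rw [h5, ← Finset.mul_sum, ← Finset.mul_sum, pairRate, pairPhase]
  push_cast
  ring

theorem vecPot_inner (α : ℝ) (j : Fin N) (x : Fin N → ℂ) (e : ℂ) :
    (vecPot α j x).re * e.re + (vecPot α j x).im * e.im =
      α * ∑ l ∈ Finset.univ.erase j, (e / (x j - x l)).im := by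
  have h : ∀ z : ℂ, (Complex.I * z / ((‖z‖ : ℂ) ^ 2)).re * e.re +
      (Complex.I * z / ((‖z‖ : ℂ) ^ 2)).im * e.im = (e / z).im := by
    intro z
    rw [← Complex.ofReal_pow, ← Complex.normSq_eq_norm_sq, Complex.div_ofReal_re,
      Complex.div_ofReal_im, Complex.div_im, Complex.I_mul_re, Complex.I_mul_im]
    ring
  simp only [vecPot, Complex.re_ofReal_mul, Complex.im_ofReal_mul, Complex.re_sum, Complex.im_sum,
    ← h]
  rw [Finset.sum_add_distrib, ← Finset.sum_mul, ← Finset.sum_mul]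
  ring

theorem I_mul_covD_sub (α : ℝ) (u : (Fin N → ℂ) → ℂ) (hjk : j ≠ k) (x : Fin N → ℂ) (e : ℂ) :
    Complex.I * (covD α u j x e - covD α u k x e) =
      fderiv ℝ u x (Pi.single j e - Pi.single k e) +
        Complex.I * (α * pairRate j k x e : ℝ) * u x := by
  have h1 : ∑ l ∈ Finset.univ.erase j, (e / (x j - x l)).im -
      ∑ l ∈ Finset.univ.erase k, (e / (x k - x l)).im = pairRate j k x e := by
    rw [← Finset.add_sum_erase (Finset.univ.erase j) _
      (Finset.mem_erase.2 ⟨hjk.symm, Finset.mem_univ k⟩),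
      ← Finset.add_sum_erase (Finset.univ.erase k) _ (Finset.mem_erase.2 ⟨hjk, Finset.mem_univ j⟩),
      Finset.erase_right_comm (a := k), pairRate, Finset.sum_sub_distrib,
      ← neg_sub (x j) (x k), div_neg, Complex.neg_im]
    ring
  rw [← h1, covD, covD, vecPot_inner, vecPot_inner, map_sub]
  push_cast
  linear_combination (-fderiv ℝ u x (Pi.single j e) + fderiv ℝ u x (Pi.single k e)) *
    Complex.I_mul_I

/-- Along the relative rotation of two particles, the function `u ^ ν * pairPhase μ j k` is
differentiable, with derivative controlled by the covariant derivatives of `u`. -/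
theorem exists_hasDerivAt_pow_mul_pairPhase {u : (Fin N → ℂ) → ℂ} (hu : IsAnyonWF N u)
    (m : ℤ) {n : ℕ} (hn : 0 < n) {α : ℝ} (hα : α = m / n) (hjk : j ≠ k) {γ : ℝ → Fin N → ℂ}
    {e : ℂ} {t : ℝ} (hγ : HasDerivAt γ (Pi.single j e - Pi.single k e) t) :
    ∃ d, HasDerivAt (fun s => u (γ s) ^ n * pairPhase m j k (γ s)) d t ∧
      ‖d‖ ≤ n * ‖u (γ t)‖ ^ (n - 1) * ‖covD α u j (γ t) e - covD α u k (γ t) e‖ := by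
  by_cases ht : γ t ∈ tsupport u
  · have hx := hu.offDiagonal _ ht
    have h1 : HasDerivAt (fun s => u (γ s)) (fderiv ℝ u (γ t) (Pi.single j e - Pi.single k e)) t :=
      ((hu.smooth.differentiable (by simp)) _).hasFDerivAt.comp_hasDerivAt t hγ
    refine ⟨_, (h1.fun_pow n).fun_mul (hasDerivAt_pairPhase m hjk hγ hx), le_of_eq ?_⟩
    have h2 := I_mul_covD_sub α u hjk (γ t) e
    have hn' : (n : ℂ) ≠ 0 := Nat.cast_ne_zero.2 hn.ne'
    have hpow : u (γ t) ^ n = u (γ t) ^ (n - 1) * u (γ t) := (pow_sub_one_mul hn.ne' _).symm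
    have h3 : (n * u (γ t) ^ (n - 1) * fderiv ℝ u (γ t) (Pi.single j e - Pi.single k e)) *
        pairPhase m j k (γ t) +
        u (γ t) ^ n * (m * (Complex.I * pairRate j k (γ t) e) * pairPhase m j k (γ t)) =
        n * u (γ t) ^ (n - 1) * (Complex.I * (covD α u j (γ t) e - covD α u k (γ t) e)) *
          pairPhase m j k (γ t) := by
      rw [h2, hα, hpow]
      push_cast
      field_simp
    rw [h3, norm_mul, norm_pairPhase m hjk hx]
    simp
  · refine ⟨0, ?_, by rw [norm_zero]; positivity⟩
    have h1 : ∀ᶠ y in nhds (γ t), u y = 0 := notMem_tsupport_iff_eventuallyEq.1 ht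
    refine (hasDerivAt_const t (0 : ℂ)).congr_of_eventuallyEq ?_
    filter_upwards [hγ.continuousAt.eventually h1] with s hs
    rw [hs, zero_pow hn.ne', zero_mul]

end pairPhase

/-- The kinetic energy of particles `j` and `k`, weighted by the square of half their distance. -/
def pairEnergy (α : ℝ) {N : ℕ} (u : (Fin N → ℂ) → ℂ) (j k : Fin N) (x : Fin N → ℂ) : ℝ :=
  ‖(x j - x k) / 2‖ ^ 2 * (covSq α u j x + covSq α u k x)

section exclusion

variable {α : ℝ} {N : ℕ} {u : (Fin N → ℂ) → ℂ} {j k : Fin N}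

theorem pairEnergy_nonneg (x : Fin N → ℂ) : 0 ≤ pairEnergy α u j k x :=
  mul_nonneg (sq_nonneg _) (add_nonneg (covSq_nonneg _ _) (covSq_nonneg _ _))

theorem measurable_pairEnergy (hu : ContDiff ℝ (⊤ : ℕ∞) u) :
    Measurable (pairEnergy α u j k) := by
  have h1 := measurable_covSq (α := α) hu j
  have h2 := measurable_covSq (α := α) hu k
  unfold pairEnergy
  fun_prop

theorem norm_covD_sub_sq_le (x : Fin N → ℂ) {e : ℂ} (he : ‖e‖ = ‖(x j - x k) / 2‖) :
    ‖covD α u j x e - covD α u k x e‖ ^ 2 ≤ 2 * pairEnergy α u j k x := by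
  have h1 := norm_covD_sq_le (α := α) (u := u) j x e
  have h2 := norm_covD_sq_le (α := α) (u := u) k x e
  rw [he] at h1 h2
  have h3 := norm_sub_le (covD α u j x e) (covD α u k x e)
  rw [pairEnergy]
  calc _ ≤ (‖covD α u j x e‖ + ‖covD α u k x e‖) ^ 2 := by gcongr
    _ ≤ 2 * (‖covD α u j x e‖ ^ 2 + ‖covD α u k x e‖ ^ 2) := add_sq_le
    _ ≤ _ := by linarith

theorem exists_isMaxOn_rotation (hu : IsAnyonWF N u) (hjk : j ≠ k) (x : Fin N → ℂ) :
    ∃ t ∈ Set.Icc 0 Real.pi, ∀ s ∈ Set.Icc 0 (2 * Real.pi),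
      ‖u (pairRotation j k (Complex.exp (s * Complex.I)) x)‖ ≤
        ‖u (pairRotation j k (Complex.exp (t * Complex.I)) x)‖ := by
  have hcont : Continuous fun s : ℝ => ‖u (pairRotation j k (Complex.exp (s * Complex.I)) x)‖ :=
    (hu.smooth.continuous.comp (continuous_pairRotation_exp.comp
      (continuous_const.prodMk continuous_id))).norm
  have hpi := Real.pi_pos
  obtain ⟨t, ht, hmax⟩ := isCompact_Icc.exists_isMaxOn
    (Set.nonempty_Icc.2 (by positivity : (0 : ℝ) ≤ 2 * Real.pi)) hcont.continuousOn
  rcases le_total t Real.pi with h | h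
  · exact ⟨t, ⟨ht.1, h⟩, fun s hs => hmax hs⟩
  · refine ⟨t - Real.pi, ⟨by linarith, by linarith [ht.2]⟩, fun s hs => (hmax hs).trans_eq ?_⟩
    have h1 : Complex.exp (((t - Real.pi : ℝ) : ℂ) * Complex.I) =
        -Complex.exp (t * Complex.I) := by
      push_cast
      rw [sub_mul, Complex.exp_sub, Complex.exp_pi_mul_I]
      ring
    simp only [h1, pairRotation_neg hjk, hu.symmetric]

theorem ofReal_normSq_le_lintegral_pairEnergy (hu : IsAnyonWF N u) {m : ℤ} (hm : Odd m) {n : ℕ}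
    (hn : 0 < n) (hα : α = m / n) (hjk : j ≠ k) (x : Fin N → ℂ) :
    ENNReal.ofReal (‖u x‖ ^ 2) ≤ ENNReal.ofReal (Real.pi * n ^ 2) *
      ∫⁻ θ in Set.Icc 0 (2 * Real.pi), ENNReal.ofReal
        (pairEnergy α u j k (pairRotation j k (Complex.exp (θ * Complex.I)) x)) := by
  have hpi := Real.pi_pos
  have hn' : (0 : ℝ) < n := Nat.cast_pos.2 hn
  set γ : ℝ → Fin N → ℂ := fun θ => pairRotation j k (Complex.exp (θ * Complex.I)) x with hγdef
  have hγc : Continuous γ :=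
    continuous_pairRotation_exp.comp (continuous_const.prodMk continuous_id)
  obtain ⟨t, ht, hmax⟩ := exists_isMaxOn_rotation hu hjk x
  set M := ‖u (γ t)‖ with hM
  have hx : ‖u x‖ ≤ M := by
    have := hmax 0 ⟨le_rfl, by positivity⟩
    simpa [pairRotation_one] using this
  rcases eq_or_lt_of_le (norm_nonneg (u (γ t))) with hM0 | hM0
  · rw [hM, ← hM0] at hx
    simp [le_antisymm hx (norm_nonneg _)]
  rw [← hM] at hM0
  have hE : ∀ θ, 0 ≤ pairEnergy α u j k (γ θ) := fun θ => pairEnergy_nonneg _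
  have hEm : Measurable fun θ => pairEnergy α u j k (γ θ) :=
    (measurable_pairEnergy hu.smooth).comp hγc.measurable
  rcases eq_or_ne (∫⁻ θ in Set.Icc 0 (2 * Real.pi), ENNReal.ofReal
    (pairEnergy α u j k (γ θ))) ⊤ with htop | htop
  · rw [htop, ENNReal.mul_top (by positivity)]; exact le_top
  set Y : ℝ → ℂ := fun s => u (γ s) ^ n * pairPhase m j k (γ s) with hY
  have hderiv : ∀ s, ∃ d, HasDerivAt Y d s ∧
      ‖d‖ ≤ n * ‖u (γ s)‖ ^ (n - 1) * √(2 * pairEnergy α u j k (γ s)) := by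
    intro s
    obtain ⟨d, hd, hle⟩ := exists_hasDerivAt_pow_mul_pairPhase hu m hn hα hjk
      (hasDerivAt_pairRotation_exp hjk x s)
    refine ⟨d, hd, hle.trans ?_⟩
    gcongr
    refine Real.le_sqrt_of_sq_le (norm_covD_sub_sq_le _ ?_)
    rw [pairRotation_sub hjk, mul_div_assoc, norm_mul, Complex.norm_I, one_mul]
  have hYt : ‖Y (t + Real.pi) - Y t‖ = 2 * M ^ n := by
    have h1 : Complex.exp (((t + Real.pi : ℝ) : ℂ) * Complex.I) =
        -Complex.exp (t * Complex.I) := by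
      push_cast
      rw [add_mul, Complex.exp_add, Complex.exp_pi_mul_I]
      ring
    have h2 : Y (t + Real.pi) = -Y t := by
      simp only [hY, hγdef, h1, pairRotation_neg hjk, hu.symmetric, pairPhase_swap hm, mul_neg]
    have h3 : γ t ∈ tsupport u := subset_tsupport u (norm_pos_iff.1 hM0)
    rw [h2, ← neg_add', norm_neg, ← two_mul, norm_mul, hY]
    simp only [norm_mul, norm_pow, norm_pairPhase m hjk (hu.offDiagonal _ h3)]
    simp [hM]
  have hgm : Measurable fun s => n * ‖u (γ s)‖ ^ (n - 1) * √(2 * pairEnergy α u j k (γ s)) := by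
    have h1 : Measurable fun s => ‖u (γ s)‖ := (hu.smooth.continuous.comp hγc).norm.measurable
    fun_prop
  have h1 := ofReal_norm_sub_le_lintegral (a := t) (b := t + Real.pi)
    (fun s => (hderiv s).choose_spec.1.differentiableAt) hgm
    (fun s => by rw [(hderiv s).choose_spec.1.deriv]; exact (hderiv s).choose_spec.2) (by linarith)
  rw [hYt] at h1
  have h2 : ∀ s ∈ Set.Icc 0 (2 * Real.pi),
      ENNReal.ofReal (n * ‖u (γ s)‖ ^ (n - 1) * √(2 * pairEnergy α u j k (γ s))) ≤
      ENNReal.ofReal (M ^ n / (2 * Real.pi)) + ENNReal.ofReal (M ^ n / M ^ 2 * (Real.pi * n ^ 2)) *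
        ENNReal.ofReal (pairEnergy α u j k (γ s)) := by
    intro s hs
    rw [← ENNReal.ofReal_mul (by positivity),
      ← ENNReal.ofReal_add (by positivity) (mul_nonneg (by positivity) (hE s))]
    refine ENNReal.ofReal_le_ofReal ?_
    have h3 : ‖u (γ s)‖ ^ (n - 1) ≤ M ^ (n - 1) := pow_le_pow_left₀ (norm_nonneg _) (hmax s hs) _
    set d := √(2 * pairEnergy α u j k (γ s)) with hd
    have hd2 : pairEnergy α u j k (γ s) = d ^ 2 / 2 := by
      rw [hd, Real.sq_sqrt (by linarith [hE s])]; ring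
    have hpow : M ^ n = M ^ (n - 1) * M := (pow_sub_one_mul hn.ne' _).symm
    calc _ ≤ n * M ^ (n - 1) * d := by gcongr
      _ ≤ _ := by
        rw [hd2, hpow]
        have h4 : M ^ (n - 1) * M / (2 * Real.pi) +
            M ^ (n - 1) * M / M ^ 2 * (Real.pi * n ^ 2) * (d ^ 2 / 2) - n * M ^ (n - 1) * d =
            M ^ (n - 1) / (2 * Real.pi * M) * (M - Real.pi * n * d) ^ 2 := by
          field_simp
          ring
        have h5 : 0 ≤ M ^ (n - 1) / (2 * Real.pi * M) * (M - Real.pi * n * d) ^ 2 := by positivity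
        linarith
  have h3 : ENNReal.ofReal (2 * M ^ n) ≤ ENNReal.ofReal (M ^ n) +
      ENNReal.ofReal (M ^ n / M ^ 2 * (Real.pi * n ^ 2)) *
        ∫⁻ θ in Set.Icc 0 (2 * Real.pi), ENNReal.ofReal (pairEnergy α u j k (γ θ)) := by
    refine (h1.trans (lintegral_mono_set (Set.Icc_subset_Icc ht.1 (by linarith [ht.2])))).trans
      ((setLIntegral_mono' measurableSet_Icc h2).trans_eq ?_)
    rw [lintegral_add_left measurable_const, lintegral_const_mul _ hEm.ennreal_ofReal,
      setLIntegral_const, Real.volume_Icc, ← ENNReal.ofReal_mul (by positivity)]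
    congr 3
    field_simp
    ring
  set J := ∫⁻ θ in Set.Icc 0 (2 * Real.pi), ENNReal.ofReal (pairEnergy α u j k (γ θ))
  rw [← ENNReal.ofReal_toReal htop, ← ENNReal.ofReal_mul (by positivity),
    ← ENNReal.ofReal_add (by positivity) (by positivity),
    ENNReal.ofReal_le_ofReal_iff (by positivity)] at h3
  rw [← ENNReal.ofReal_toReal htop, ← ENNReal.ofReal_mul (by positivity)]
  refine ENNReal.ofReal_le_ofReal ?_
  have h4 : M ^ n ≤ M ^ n / M ^ 2 * (Real.pi * n ^ 2) * J.toReal := by linarith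
  have h5 : M ^ n / M ^ 2 * (Real.pi * n ^ 2) * J.toReal =
      M ^ n * ((Real.pi * n ^ 2) * J.toReal / M ^ 2) := by ring
  rw [h5, le_mul_iff_one_le_right (by positivity), one_le_div (by positivity)] at h4
  exact (pow_le_pow_left₀ (norm_nonneg _) hx 2).trans h4

/-- The pairwise exclusion principle, for a weight invariant under relative rotations. -/
theorem lintegral_weight_normSq_le (hu : IsAnyonWF N u) {m : ℤ} (hm : Odd m) {n : ℕ}
    (hn : 0 < n) (hα : α = m / n) (hjk : j ≠ k) {W : (Fin N → ℂ) → ENNReal} (hW : Measurable W)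
    (hinv : ∀ c : ℂ, ‖c‖ = 1 → ∀ x, W (pairRotation j k c x) = W x) :
    ∫⁻ x, W x * ENNReal.ofReal (‖u x‖ ^ 2) ≤
      ENNReal.ofReal (2 * Real.pi ^ 2 * n ^ 2) *
        ∫⁻ x, W x * ENNReal.ofReal (pairEnergy α u j k x) := by
  have hpi := Real.pi_pos
  have hG : Measurable fun x => ENNReal.ofReal (pairEnergy α u j k x) :=
    (measurable_pairEnergy hu.smooth).ennreal_ofReal
  have hc : ∀ θ : ℝ, ‖Complex.exp (θ * Complex.I)‖ = 1 := Complex.norm_exp_ofReal_mul_I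
  have hWG : Measurable fun p : (Fin N → ℂ) × ℝ =>
      W (pairRotation j k (Complex.exp (p.2 * Complex.I)) p.1) * ENNReal.ofReal
        (pairEnergy α u j k (pairRotation j k (Complex.exp (p.2 * Complex.I)) p.1)) :=
    (hW.mul hG).comp continuous_pairRotation_exp.measurable
  calc ∫⁻ x, W x * ENNReal.ofReal (‖u x‖ ^ 2)
      ≤ ∫⁻ x, ENNReal.ofReal (Real.pi * n ^ 2) * ∫⁻ θ in Set.Icc 0 (2 * Real.pi),
          W (pairRotation j k (Complex.exp (θ * Complex.I)) x) * ENNReal.ofReal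
            (pairEnergy α u j k (pairRotation j k (Complex.exp (θ * Complex.I)) x)) := by
        refine lintegral_mono fun x => ?_
        simp only [hinv _ (hc _)]
        have hGx : Measurable fun θ : ℝ => ENNReal.ofReal
            (pairEnergy α u j k (pairRotation j k (Complex.exp (θ * Complex.I)) x)) :=
          hG.comp (continuous_pairRotation_exp.comp
            (continuous_const.prodMk continuous_id)).measurable
        rw [lintegral_const_mul _ hGx, mul_left_comm]
        exact mul_le_mul_right (ofReal_normSq_le_lintegral_pairEnergy hu hm hn hα hjk x) _
    _ = ENNReal.ofReal (Real.pi * n ^ 2) * ∫⁻ θ in Set.Icc 0 (2 * Real.pi),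
          ∫⁻ x, W x * ENNReal.ofReal (pairEnergy α u j k x) := by
        rw [lintegral_const_mul _ hWG.lintegral_prod_right', lintegral_lintegral_swap
          hWG.aemeasurable]
        congr 1
        exact lintegral_congr fun θ =>
          (measurePreserving_pairRotation hjk (hc θ)).lintegral_comp (hW.mul hG)
    _ = _ := by
        rw [setLIntegral_const, Real.volume_Icc, mul_comm (∫⁻ x, _), ← mul_assoc,
          ← ENNReal.ofReal_mul (by positivity)]
        congr 2
        ring

end exclusion

/-- The number of particles of the configuration `x` in the region `Q`. -/
def particleCount {N : ℕ} (Q : Set (ℝ × ℝ)) (x : Fin N → ℂ) : ENNReal :=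
  ∑ l, Q.indicator 1 (Complex.measurableEquivRealProd (x l))

/-- The configurations whose particles `j` and `k` stay in the square of center `c` and half side
`r` under every rotation of their relative coordinate. -/
def pairRegion {N : ℕ} (j k : Fin N) (c : ℝ × ℝ) (r : ℝ) : Set (Fin N → ℂ) :=
  {x | |((x j + x k) / 2).re - c.1| + ‖(x j - x k) / 2‖ ≤ r ∧
    |((x j + x k) / 2).im - c.2| + ‖(x j - x k) / 2‖ ≤ r}

/-- The indicator of `pairRegion`, divided by the number of particles in the square. -/
def pairWeight {N : ℕ} (j k : Fin N) (c : ℝ × ℝ) (r : ℝ) : (Fin N → ℂ) → ENNReal :=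
  (pairRegion j k c r).indicator fun x => (2 + ∑ l ∈ (Finset.univ.erase j).erase k,
    (Metric.closedBall c r).indicator 1 (Complex.measurableEquivRealProd (x l)))⁻¹

section pairWeight

variable {N : ℕ} {j k : Fin N} {c : ℝ × ℝ} {r : ℝ}

theorem mem_closedBall_iff (y : ℂ) : Complex.measurableEquivRealProd y ∈ Metric.closedBall c r ↔
    |y.re - c.1| ≤ r ∧ |y.im - c.2| ≤ r := by
  rw [mem_closedBall_iff_norm, Prod.norm_def, max_le_iff]
  rfl

theorem measurableSet_pairRegion : MeasurableSet (pairRegion j k c r) := by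
  refine MeasurableSet.inter ?_ ?_
  · exact measurableSet_le (f := fun x : Fin N → ℂ =>
      |((x j + x k) / 2).re - c.1| + ‖(x j - x k) / 2‖) (by fun_prop) measurable_const
  · exact measurableSet_le (f := fun x : Fin N → ℂ =>
      |((x j + x k) / 2).im - c.2| + ‖(x j - x k) / 2‖) (by fun_prop) measurable_const

theorem measurable_indicator_particle {Q : Set (ℝ × ℝ)} (hQ : MeasurableSet Q) (l : Fin N) :
    Measurable fun x : Fin N → ℂ =>
      (Q.indicator 1 (Complex.measurableEquivRealProd (x l)) : ENNReal) :=
  (measurable_one.indicator hQ).comp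
    (Complex.measurableEquivRealProd.measurable.comp (measurable_pi_apply l))

theorem measurable_particleCount {Q : Set (ℝ × ℝ)} (hQ : MeasurableSet Q) :
    Measurable (particleCount Q : (Fin N → ℂ) → ENNReal) :=
  Finset.measurable_sum _ fun l _ => measurable_indicator_particle hQ l

theorem measurable_pairWeight : Measurable (pairWeight j k c r) := by
  refine Measurable.indicator ?_ measurableSet_pairRegion
  exact ((Finset.measurable_sum _ fun l _ => measurable_indicator_particle
    measurableSet_closedBall l).const_add 2).inv

theorem pairWeight_pairRotation (hjk : j ≠ k) (d : ℂ) (hd : ‖d‖ = 1) (x : Fin N → ℂ) :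
    pairWeight j k c r (pairRotation j k d x) = pairWeight j k c r x := by
  have h1 : pairRotation j k d x ∈ pairRegion j k c r ↔ x ∈ pairRegion j k c r := by
    simp only [pairRegion, Set.mem_ofPred_eq, pairRotation_sub hjk, pairRotation_add hjk,
      mul_div_assoc, norm_mul, hd, one_mul]
  have h2 : ∀ l ∈ (Finset.univ.erase j).erase k, pairRotation j k d x l = x l := fun l hl => by
    simp only [Finset.mem_erase, Finset.mem_univ, and_true] at hl
    exact pairRotation_other hl.2 hl.1 d x
  unfold pairWeight
  by_cases h : x ∈ pairRegion j k c r
  · rw [Set.indicator_of_mem h, Set.indicator_of_mem (h1.2 h)]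
    congr 2
    exact Finset.sum_congr rfl fun l hl => by rw [h2 l hl]
  · rw [Set.indicator_of_notMem h, Set.indicator_of_notMem (fun h' => h (h1.1 h'))]

theorem mem_closedBall_of_mem_pairRegion {x : Fin N → ℂ} (hx : x ∈ pairRegion j k c r) :
    Complex.measurableEquivRealProd (x j) ∈ Metric.closedBall c r ∧
      Complex.measurableEquivRealProd (x k) ∈ Metric.closedBall c r := by
  obtain ⟨h1, h2⟩ := hx
  have h3 := Complex.abs_re_le_norm ((x j - x k) / 2)
  have h4 := Complex.abs_im_le_norm ((x j - x k) / 2)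
  have hj : x j = (x j + x k) / 2 + (x j - x k) / 2 := by ring
  have hk : x k = (x j + x k) / 2 - (x j - x k) / 2 := by ring
  rw [mem_closedBall_iff, mem_closedBall_iff]
  generalize (x j + x k) / 2 = a at *
  generalize (x j - x k) / 2 = b at *
  rw [hj, hk]
  simp only [Complex.add_re, Complex.add_im, Complex.sub_re, Complex.sub_im, abs_le] at *
  obtain ⟨h5, h6⟩ := h3
  obtain ⟨h7, h8⟩ := h4
  have h9 := le_abs_self (a.re - c.1)
  have h10 := neg_abs_le (a.re - c.1)
  have h11 := le_abs_self (a.im - c.2)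
  have h12 := neg_abs_le (a.im - c.2)
  refine ⟨⟨⟨?_, ?_⟩, ⟨?_, ?_⟩⟩, ⟨⟨?_, ?_⟩, ⟨?_, ?_⟩⟩⟩ <;> linarith

theorem mem_pairRegion {x : Fin N → ℂ}
    (hj : Complex.measurableEquivRealProd (x j) ∈ Metric.closedBall c r)
    (hk : Complex.measurableEquivRealProd (x k) ∈ Metric.closedBall c r) :
    x ∈ pairRegion j k c (3 * r) := by
  rw [mem_closedBall_iff] at hj hk
  have h := Complex.norm_le_abs_re_add_abs_im ((x j - x k) / 2)
  have h1 : ((x j + x k) / 2).re = ((x j).re + (x k).re) / 2 := by simp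
  have h2 : ((x j + x k) / 2).im = ((x j).im + (x k).im) / 2 := by simp
  have h3 : ((x j - x k) / 2).re = ((x j).re - (x k).re) / 2 := by simp
  have h4 : ((x j - x k) / 2).im = ((x j).im - (x k).im) / 2 := by simp
  rw [h3, h4] at h
  simp only [abs_le] at hj hk
  obtain ⟨⟨a1, a2⟩, a3, a4⟩ := hj
  obtain ⟨⟨b1, b2⟩, b3, b4⟩ := hk
  have h5 : |((x j).re - (x k).re) / 2| ≤ r := abs_le.2 ⟨by linarith, by linarith⟩
  have h6 : |((x j).im - (x k).im) / 2| ≤ r := abs_le.2 ⟨by linarith, by linarith⟩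
  have h7 : |((x j).re + (x k).re) / 2 - c.1| ≤ r := abs_le.2 ⟨by linarith, by linarith⟩
  have h8 : |((x j).im + (x k).im) / 2 - c.2| ≤ r := abs_le.2 ⟨by linarith, by linarith⟩
  refine ⟨?_, ?_⟩
  · rw [h1]; linarith
  · rw [h2]; linarith

theorem particleCount_eq (hjk : j ≠ k) (Q : Set (ℝ × ℝ)) (x : Fin N → ℂ)
    (hj : Complex.measurableEquivRealProd (x j) ∈ Q)
    (hk : Complex.measurableEquivRealProd (x k) ∈ Q) :
    particleCount Q x = 2 + ∑ l ∈ (Finset.univ.erase j).erase k,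
      Q.indicator 1 (Complex.measurableEquivRealProd (x l)) := by
  rw [particleCount, ← Finset.add_sum_erase _ _ (Finset.mem_univ j),
    ← Finset.add_sum_erase _ _ (Finset.mem_erase.2 ⟨hjk.symm, Finset.mem_univ k⟩), ← add_assoc]
  rw [Set.indicator_of_mem hj, Set.indicator_of_mem hk, Pi.one_apply, Pi.one_apply,
    one_add_one_eq_two]

theorem pairWeight_eq (hjk : j ≠ k) {x : Fin N → ℂ} (hx : x ∈ pairRegion j k c r) :
    pairWeight j k c r x = (particleCount (Metric.closedBall c r) x)⁻¹ := by
  obtain ⟨hj, hk⟩ := mem_closedBall_of_mem_pairRegion hx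
  rw [pairWeight, Set.indicator_of_mem hx, particleCount_eq hjk _ x hj hk]

theorem pairWeight_mul_pairEnergy_le {α : ℝ} {u : (Fin N → ℂ) → ℂ} (hjk : j ≠ k)
    (x : Fin N → ℂ) :
    pairWeight j k c r x * ENNReal.ofReal (pairEnergy α u j k x) ≤
      ENNReal.ofReal (r ^ 2) * (particleCount (Metric.closedBall c r) x)⁻¹ *
      ((Metric.closedBall c r).indicator 1 (Complex.measurableEquivRealProd (x j)) *
        (Metric.closedBall c r).indicator 1 (Complex.measurableEquivRealProd (x k)) *
        (ENNReal.ofReal (covSq α u j x) + ENNReal.ofReal (covSq α u k x))) := by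
  by_cases hx : x ∈ pairRegion j k c r
  · obtain ⟨hj, hk⟩ := mem_closedBall_of_mem_pairRegion hx
    have hw : ‖(x j - x k) / 2‖ ≤ r := by
      have := abs_nonneg (((x j + x k) / 2).re - c.1)
      linarith [hx.1]
    have h1 : ENNReal.ofReal (‖(x j - x k) / 2‖ ^ 2) ≤ ENNReal.ofReal (r ^ 2) :=
      ENNReal.ofReal_le_ofReal (pow_le_pow_left₀ (norm_nonneg _) hw 2)
    rw [pairWeight_eq hjk hx, pairEnergy, ENNReal.ofReal_mul (by positivity),
      ENNReal.ofReal_add (covSq_nonneg _ _) (covSq_nonneg _ _), Set.indicator_of_mem hj,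
      Set.indicator_of_mem hk]
    simp only [Pi.one_apply, one_mul]
    rw [mul_comm (ENNReal.ofReal (r ^ 2)), mul_assoc]
    gcongr
  · simp [pairWeight, Set.indicator_of_notMem hx]

theorem sum_pairWeight_mul_pairEnergy_le {α : ℝ} {u : (Fin N → ℂ) → ℂ} (x : Fin N → ℂ) :
    ∑ p ∈ (Finset.univ : Finset (Fin N)).offDiag,
      pairWeight p.1 p.2 c r x * ENNReal.ofReal (pairEnergy α u p.1 p.2 x) ≤
      ENNReal.ofReal (2 * r ^ 2) * ∑ j, (Metric.closedBall c r).indicator 1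
        (Complex.measurableEquivRealProd (x j)) * ENNReal.ofReal (covSq α u j x) := by
  set χ : Fin N → ENNReal := fun j =>
    (Metric.closedBall c r).indicator 1 (Complex.measurableEquivRealProd (x j)) with hχ
  set n := particleCount (Metric.closedBall c r) x with hn
  have hnχ : ∑ j, χ j = n := rfl
  set τ : Fin N → ENNReal := fun j => ENNReal.ofReal (covSq α u j x)
  have h2 : ∀ a b : Fin N, χ a * χ b * (τ a + τ b) = χ a * τ a * χ b + χ a * (χ b * τ b) :=
    fun a b => by ring
  calc _ ≤ ∑ p ∈ (Finset.univ : Finset (Fin N)).offDiag,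
        ENNReal.ofReal (r ^ 2) * n⁻¹ * (χ p.1 * χ p.2 * (τ p.1 + τ p.2)) :=
        Finset.sum_le_sum fun p hp =>
          pairWeight_mul_pairEnergy_le (Finset.mem_offDiag.1 hp).2.2 x
    _ ≤ ∑ p : Fin N × Fin N, ENNReal.ofReal (r ^ 2) * n⁻¹ *
        (χ p.1 * χ p.2 * (τ p.1 + τ p.2)) :=
        Finset.sum_le_sum_of_subset (Finset.subset_univ _)
    _ = ENNReal.ofReal (r ^ 2) * (n⁻¹ * n) * (2 * ∑ j, χ j * τ j) := by
        rw [← Finset.mul_sum, Fintype.sum_prod_type]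
        simp only [h2, Finset.sum_add_distrib, ← Finset.mul_sum, ← Finset.sum_mul, hnχ]
        ring
    _ ≤ ENNReal.ofReal (r ^ 2) * 1 * (2 * ∑ j, χ j * τ j) := by
        gcongr
        exact ENNReal.inv_mul_le_one n
    _ = _ := by
        rw [ENNReal.ofReal_mul (by norm_num), ENNReal.ofReal_ofNat]
        ring

theorem particleCount_eq_card (Q : Set (ℝ × ℝ)) (x : Fin N → ℂ) [DecidablePred fun j : Fin N =>
    Complex.measurableEquivRealProd (x j) ∈ Q] : particleCount Q x =
      ((Finset.univ.filter fun j => Complex.measurableEquivRealProd (x j) ∈ Q).card : ENNReal) := by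
  rw [particleCount, Finset.card_filter, Nat.cast_sum]
  refine Finset.sum_congr rfl fun j _ => ?_
  by_cases h : Complex.measurableEquivRealProd (x j) ∈ Q
  · rw [Set.indicator_of_mem h, if_pos h, Pi.one_apply, Nat.cast_one]
  · rw [Set.indicator_of_notMem h, if_neg h, Nat.cast_zero]

theorem two_mul_natCast_le {a : ℝ} (ha : 0 ≤ a) {p q : ℕ} (hpq : p ≤ q) :
    ENNReal.ofReal (2 * a) * p ≤
      ((p * p - p : ℕ) : ENNReal) * (q : ENNReal)⁻¹ + ENNReal.ofReal (a ^ 2) * q + 1 := by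
  rcases Nat.eq_zero_or_pos q with rfl | hq
  · simp [Nat.le_zero.1 hpq]
  have hq' : (0 : ℝ) < q := Nat.cast_pos.2 hq
  have hpp : p ≤ p * p := Nat.le_mul_self p
  rw [← ENNReal.ofReal_natCast, ← ENNReal.ofReal_natCast, ← ENNReal.ofReal_natCast,
    ← ENNReal.ofReal_inv_of_pos hq', ← ENNReal.ofReal_one, ← ENNReal.ofReal_mul (by positivity),
    ← ENNReal.ofReal_mul (by positivity), ← ENNReal.ofReal_mul (by positivity),
    ← ENNReal.ofReal_add (by positivity) (by positivity),
    ← ENNReal.ofReal_add (by positivity) (by positivity)]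
  refine ENNReal.ofReal_le_ofReal ?_
  have hpq' : (p : ℝ) ≤ q := Nat.cast_le.2 hpq
  rw [Nat.cast_sub hpp, Nat.cast_mul]
  have h1 : ((p : ℝ) * p - p) * (q : ℝ)⁻¹ + a ^ 2 * q + 1 - 2 * a * p =
      ((p - a * q) ^ 2 + (q - p)) / q := by field_simp; ring
  have h2 : 0 ≤ (((p : ℝ) - a * q) ^ 2 + (q - p)) / q :=
    div_nonneg (add_nonneg (sq_nonneg _) (by linarith)) hq'.le
  linarith

theorem particleCount_le_sum_pairWeight {a : ℝ} (ha : 0 ≤ a) (hr : 0 ≤ r) (x : Fin N → ℂ) :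
    ENNReal.ofReal (2 * a) * particleCount (Metric.closedBall c r) x ≤
      (∑ p ∈ (Finset.univ : Finset (Fin N)).offDiag, pairWeight p.1 p.2 c (3 * r) x) +
        ENNReal.ofReal (a ^ 2) * particleCount (Metric.closedBall c (3 * r)) x + 1 := by
  classical
  set s := Finset.univ.filter fun j =>
    Complex.measurableEquivRealProd (x j) ∈ Metric.closedBall c r with hs
  have hle : s.card ≤ (Finset.univ.filter fun j =>
      Complex.measurableEquivRealProd (x j) ∈ Metric.closedBall c (3 * r)).card := by
    refine Finset.card_le_card fun j hj => ?_
    simp only [hs, Finset.mem_filter, Finset.mem_univ, true_and] at hj ⊢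
    exact Metric.closedBall_subset_closedBall (by linarith) hj
  have h := two_mul_natCast_le ha hle
  rw [← particleCount_eq_card, ← particleCount_eq_card, ← Finset.offDiag_card] at h
  refine h.trans ?_
  gcongr
  rw [← nsmul_eq_mul, ← Finset.sum_const]
  calc _ ≤ ∑ p ∈ s.offDiag, pairWeight p.1 p.2 c (3 * r) x := by
        refine Finset.sum_le_sum fun p hp => ?_
        obtain ⟨h1, h2, h3⟩ := Finset.mem_offDiag.1 hp
        simp only [hs, Finset.mem_filter, Finset.mem_univ, true_and] at h1 h2
        rw [pairWeight_eq h3 (mem_pairRegion h1 h2)]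
    _ ≤ _ := Finset.sum_le_sum_of_subset (Finset.offDiag_mono (Finset.subset_univ s))

end pairWeight

section localBounds

variable {α : ℝ} {N : ℕ} {u : (Fin N → ℂ) → ℂ} {c : ℝ × ℝ} {r : ℝ}

theorem setLIntegral_massMarginal (hu : ContDiff ℝ (⊤ : ℕ∞) u) {Q : Set (ℝ × ℝ)}
    (hQ : MeasurableSet Q) :
    ∫⁻ p in Q, massMarginal u p = ∫⁻ x, particleCount Q x * ENNReal.ofReal (‖u x‖ ^ 2) := by
  rw [massMarginal, setLIntegral_marginal (fun _ => measurable_ofReal_normSq hu) hQ,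
    ← lintegral_finsetSum]
  · simp only [particleCount, Finset.sum_mul]
  · exact fun j _ => (measurable_indicator_particle hQ j).mul (measurable_ofReal_normSq hu)

theorem setLIntegral_energyMarginal (hu : ContDiff ℝ (⊤ : ℕ∞) u) {Q : Set (ℝ × ℝ)}
    (hQ : MeasurableSet Q) :
    ∫⁻ p in Q, energyMarginal α u p =
      ∫⁻ x, ∑ j, Q.indicator 1 (Complex.measurableEquivRealProd (x j)) *
        ENNReal.ofReal (covSq α u j x) := by
  rw [energyMarginal, setLIntegral_marginal (fun j => (measurable_covSq hu j).ennreal_ofReal) hQ,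
    ← lintegral_finsetSum]
  exact fun j _ => (measurable_indicator_particle hQ j).mul (measurable_covSq hu j).ennreal_ofReal

/-- The local exclusion principle. -/
theorem lintegral_massMarginal_le_exclusion (hu : IsAnyonWF N u) {m : ℤ} (hm : Odd m) {n : ℕ}
    (hn : 0 < n) (hα : α = m / n) {a : ℝ} (ha : 0 ≤ a) (hr : 0 ≤ r) :
    ENNReal.ofReal (2 * a) * (∫⁻ p in Metric.closedBall c r, massMarginal u p) ≤
      ENNReal.ofReal (36 * Real.pi ^ 2 * n ^ 2 * r ^ 2) *
        (∫⁻ p in Metric.closedBall c (3 * r), energyMarginal α u p) +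
      ENNReal.ofReal (a ^ 2) * (∫⁻ p in Metric.closedBall c (3 * r), massMarginal u p) +
      ∫⁻ x, ENNReal.ofReal (‖u x‖ ^ 2) := by
  have hcm : ∀ r : ℝ, Measurable fun x : Fin N → ℂ =>
      particleCount (Metric.closedBall c r) x * ENNReal.ofReal (‖u x‖ ^ 2) := fun r =>
    (measurable_particleCount measurableSet_closedBall).mul (measurable_ofReal_normSq hu.smooth)
  have hwm : ∀ p : Fin N × Fin N, Measurable fun x : Fin N → ℂ =>
      pairWeight p.1 p.2 c (3 * r) x * ENNReal.ofReal (‖u x‖ ^ 2) := fun p =>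
    measurable_pairWeight.mul (measurable_ofReal_normSq hu.smooth)
  have hwe : ∀ p : Fin N × Fin N, Measurable fun x : Fin N → ℂ =>
      pairWeight p.1 p.2 c (3 * r) x * ENNReal.ofReal (pairEnergy α u p.1 p.2 x) := fun p =>
    measurable_pairWeight.mul (measurable_pairEnergy hu.smooth).ennreal_ofReal
  have hpairs : ∫⁻ x, ∑ p ∈ (Finset.univ : Finset (Fin N)).offDiag,
      pairWeight p.1 p.2 c (3 * r) x * ENNReal.ofReal (‖u x‖ ^ 2) ≤
      ENNReal.ofReal (36 * Real.pi ^ 2 * n ^ 2 * r ^ 2) *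
        (∫⁻ p in Metric.closedBall c (3 * r), energyMarginal α u p) := by
    calc _ = ∑ p ∈ (Finset.univ : Finset (Fin N)).offDiag,
          ∫⁻ x, pairWeight p.1 p.2 c (3 * r) x * ENNReal.ofReal (‖u x‖ ^ 2) :=
          lintegral_finsetSum _ fun p _ => hwm p
      _ ≤ ∑ p ∈ (Finset.univ : Finset (Fin N)).offDiag,
          ENNReal.ofReal (2 * Real.pi ^ 2 * n ^ 2) *
          ∫⁻ x, pairWeight p.1 p.2 c (3 * r) x * ENNReal.ofReal (pairEnergy α u p.1 p.2 x) := by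
          refine Finset.sum_le_sum fun p hp => ?_
          have hp' := (Finset.mem_offDiag.1 hp).2.2
          exact lintegral_weight_normSq_le hu hm hn hα hp' measurable_pairWeight
            (pairWeight_pairRotation hp')
      _ = ENNReal.ofReal (2 * Real.pi ^ 2 * n ^ 2) *
          ∫⁻ x, ∑ p ∈ (Finset.univ : Finset (Fin N)).offDiag,
            pairWeight p.1 p.2 c (3 * r) x * ENNReal.ofReal (pairEnergy α u p.1 p.2 x) := by
          rw [← Finset.mul_sum, lintegral_finsetSum _ fun p _ => hwe p]
      _ ≤ ENNReal.ofReal (2 * Real.pi ^ 2 * n ^ 2) *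
          ∫⁻ x, ENNReal.ofReal (2 * (3 * r) ^ 2) *
            ∑ j, (Metric.closedBall c (3 * r)).indicator 1
              (Complex.measurableEquivRealProd (x j)) * ENNReal.ofReal (covSq α u j x) :=
          mul_le_mul_right (lintegral_mono sum_pairWeight_mul_pairEnergy_le) _
      _ = _ := by
          rw [lintegral_const_mul, setLIntegral_energyMarginal hu.smooth measurableSet_closedBall,
            ← mul_assoc, ← ENNReal.ofReal_mul (by positivity)]
          · congr 2
            ring
          · exact Finset.measurable_sum _ fun j _ =>
              (measurable_indicator_particle measurableSet_closedBall j).mul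
                (measurable_covSq hu.smooth j).ennreal_ofReal
  refine le_trans ?_ (add_le_add (add_le_add hpairs le_rfl) le_rfl)
  rw [setLIntegral_massMarginal hu.smooth measurableSet_closedBall,
    setLIntegral_massMarginal hu.smooth measurableSet_closedBall,
    ← lintegral_const_mul _ (hcm _), ← lintegral_const_mul _ (hcm _), ← lintegral_add_right,
    ← lintegral_add_right]
  · refine lintegral_mono fun x => ?_
    have h := mul_le_mul_left (particleCount_le_sum_pairWeight (c := c) ha hr x)
      (ENNReal.ofReal (‖u x‖ ^ 2))
    simpa only [add_mul, one_mul, mul_assoc, Finset.sum_mul] using h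
  · exact measurable_ofReal_normSq hu.smooth
  · exact (hcm _).const_mul _

/-- On a square of sufficiently large mass, the kinetic energy controls the square of the
density. -/
theorem lintegral_massMarginal_sq_le_energy (hu : IsAnyonWF N u) {m : ℤ} (hm : Odd m) {n : ℕ}
    (hn : 0 < n) (hα : α = m / n) (hnorm : ∫⁻ x, ENNReal.ofReal (‖u x‖ ^ 2) = 1) (hr : 0 < r)
    (hM : ∫⁻ p in Metric.closedBall c r, massMarginal u p = 648) :
    ∫⁻ p in Metric.closedBall c r, massMarginal u p ^ 2 ≤
      ENNReal.ofReal (1297 ^ 2 * 101 * n ^ 2) *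
        ∫⁻ p in Metric.closedBall c r, energyMarginal α u p := by
  obtain ⟨s, rfl⟩ : ∃ s, r = 3 * s := ⟨r / 3, by ring⟩
  have hs : 0 < s := by linarith
  have hn' : (1 : ℝ) ≤ n := Nat.one_le_cast.2 hn
  rcases eq_or_ne (∫⁻ p in Metric.closedBall c (3 * s), energyMarginal α u p) ⊤ with hE | hE
  · rw [hE, ENNReal.mul_top (by positivity)]
    exact le_top
  obtain ⟨E, hE0, hE⟩ : ∃ E : ℝ, 0 ≤ E ∧
      ∫⁻ p in Metric.closedBall c (3 * s), energyMarginal α u p = ENNReal.ofReal E :=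
    ⟨_, ENNReal.toReal_nonneg, (ENNReal.ofReal_toReal hE).symm⟩
  have hM₀ne : ∫⁻ p in Metric.closedBall c s, massMarginal u p ≠ ⊤ := by
    refine ne_top_of_le_ne_top ?_ (lintegral_mono_set
      (Metric.closedBall_subset_closedBall (by linarith : s ≤ 3 * s)))
    rw [hM]
    exact ENNReal.ofNat_ne_top
  obtain ⟨m₀, hm₀, hM₀⟩ : ∃ m₀ : ℝ, 0 ≤ m₀ ∧
      ∫⁻ p in Metric.closedBall c s, massMarginal u p = ENNReal.ofReal m₀ :=
    ⟨_, ENNReal.toReal_nonneg, (ENNReal.ofReal_toReal hM₀ne).symm⟩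
  have hM' : ∫⁻ p in Metric.closedBall c (3 * s), massMarginal u p = ENNReal.ofReal 648 := by
    rw [hM, ENNReal.ofReal_ofNat]
  have h1 := massMarginal_le_middle hu.smooth hs (by norm_num) hm₀ hE0 hM' hM₀ hE
  have h2 := lintegral_massMarginal_le_exclusion (c := c) hu hm hn hα
    (by norm_num : (0 : ℝ) ≤ 1 / 18) hs.le
  rw [hM', hM₀, hE, hnorm, ← ENNReal.ofReal_one, ← ENNReal.ofReal_mul (by positivity),
    ← ENNReal.ofReal_mul (by positivity), ← ENNReal.ofReal_mul (by positivity),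
    ← ENNReal.ofReal_add (by positivity) (by positivity),
    ← ENNReal.ofReal_add (by positivity) (by positivity),
    ENNReal.ofReal_le_ofReal_iff (by positivity)] at h2
  have h3 := lintegral_massMarginal_sq_le hu.smooth hr (by norm_num) hE0 hM' hE
  refine h3.trans ?_
  rw [hE, ← ENNReal.ofReal_mul (by positivity)]
  refine ENNReal.ofReal_le_ofReal ?_
  have hpi : (1 : ℝ) ≤ Real.pi ^ 2 := by nlinarith [Real.pi_gt_three]
  have hpi' : Real.pi ^ 2 ≤ 16 := by nlinarith [Real.pi_pos, Real.pi_le_four]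
  have hnn : (1 : ℝ) ≤ n ^ 2 := one_le_pow₀ hn'
  have hs2 : 0 ≤ s ^ 2 * E := by positivity
  have h4 : 1 ≤ 36 * Real.pi ^ 2 * n ^ 2 * s ^ 2 * E := by
    rcases le_total (2304 * (s ^ 2 * E)) 162 with h | h
    · linarith
    · have h5 : 1 * (s ^ 2 * E) ≤ (Real.pi ^ 2 * n ^ 2) * (s ^ 2 * E) := by
        gcongr
        exact one_le_mul_of_one_le_of_one_le hpi hnn
      linarith
  have h5 : 1 / (3 * s) ^ 2 ≤ 4 * Real.pi ^ 2 * n ^ 2 * E := by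
    rw [div_le_iff₀ (by positivity)]
    linarith
  have h6 : 4 * Real.pi ^ 2 * n ^ 2 * E ≤ 4 * 16 * n ^ 2 * E := by gcongr
  have h7 : 1 * E ≤ n ^ 2 * E := by gcongr
  have h8 : 0 ≤ (n : ℝ) ^ 2 * E := by positivity
  have h9 : E + 1 / (3 * s) ^ 2 ≤ 101 * (n ^ 2 * E) := by linarith
  calc (2 * 648 + 1) ^ 2 * (E + 1 / (3 * s) ^ 2)
      ≤ (2 * 648 + 1) ^ 2 * (101 * (n ^ 2 * E)) := by gcongr
    _ = _ := by ring

end localBounds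

theorem exists_norm_le_of_massMarginal_ne_zero {N : ℕ} {u : (Fin N → ℂ) → ℂ}
    (hu : HasCompactSupport u) : ∃ B : ℝ, ∀ p, massMarginal u p ≠ 0 → ‖p‖ ≤ B := by
  obtain ⟨B, hB⟩ := hu.isCompact.isBounded.exists_norm_le
  refine ⟨B, fun p hp => ?_⟩
  by_contra! hlt
  refine hp ?_
  rw [massMarginal, marginal]
  refine Finset.sum_eq_zero fun j _ => ?_
  have h0 : ∀ z, u (insertAt j (Complex.measurableEquivRealProd.symm p) z) = 0 := by
    intro z
    by_contra h
    have h1 := hB _ (subset_tsupport u h)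
    have h2 := (norm_le_pi_norm (insertAt j (Complex.measurableEquivRealProd.symm p) z) j).trans h1
    rw [insertAt_self] at h2
    have h3 : ‖p‖ ≤ ‖Complex.measurableEquivRealProd.symm p‖ := by
      rw [Prod.norm_def]
      exact max_le (Complex.abs_re_le_norm (Complex.measurableEquivRealProd.symm p))
        (Complex.abs_im_le_norm (Complex.measurableEquivRealProd.symm p))
    linarith
  simp only [h0, norm_zero, ne_eq, OfNat.ofNat_ne_zero, not_false_eq_true, zero_pow,
    ENNReal.ofReal_zero, lintegral_zero]

theorem lintegral_massMarginal {N : ℕ} {u : (Fin N → ℂ) → ℂ} (hu : ContDiff ℝ (⊤ : ℕ∞) u)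
    (hnorm : ∫⁻ x, ENNReal.ofReal (‖u x‖ ^ 2) = 1) : ∫⁻ p, massMarginal u p = N := by
  rw [massMarginal, lintegral_marginal fun _ => measurable_ofReal_normSq hu]
  simp only [hnorm, Finset.sum_const, Finset.card_univ, Fintype.card_fin, nsmul_eq_mul, mul_one]

/-- The kinetic energy inequality for a bounded number of particles. -/
theorem lintegral_massMarginal_sq_le_of_few {α : ℝ} {N : ℕ} {u : (Fin N → ℂ) → ℂ}
    (hu : IsAnyonWF N u) (hnorm : ∫⁻ x, ENNReal.ofReal (‖u x‖ ^ 2) = 1) {T : ℝ} (hT : 0 ≤ T)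
    (hE : ∫⁻ p, energyMarginal α u p = ENNReal.ofReal T) :
    ∫⁻ p, massMarginal u p ^ 2 ≤ ENNReal.ofReal ((2 * N + 1) ^ 2 * T) := by
  obtain ⟨B, hB⟩ := exists_norm_le_of_massMarginal_ne_zero hu.compactSupport
  have hlim : Filter.Tendsto (fun r : ℝ => ENNReal.ofReal ((2 * N + 1) ^ 2 * (T + 1 / r ^ 2)))
      Filter.atTop (nhds (ENNReal.ofReal ((2 * N + 1) ^ 2 * (T + 0)))) := by
    refine (ENNReal.continuous_ofReal.tendsto _).comp (Filter.Tendsto.const_mul _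
      (Filter.Tendsto.const_add _ ?_))
    exact tendsto_const_nhds.div_atTop (Filter.tendsto_pow_atTop two_ne_zero)
  rw [add_zero] at hlim
  refine ge_of_tendsto hlim ?_
  filter_upwards [Filter.eventually_ge_atTop B, Filter.eventually_gt_atTop 0] with r hrB hr
  have hout : ∀ p ∉ Metric.closedBall (0 : ℝ × ℝ) r, massMarginal u p = 0 := fun p hp => by
    by_contra h
    exact hp (mem_closedBall_zero_iff.2 ((hB p h).trans hrB))
  have hM : ∫⁻ p in Metric.closedBall (0 : ℝ × ℝ) r, massMarginal u p = ENNReal.ofReal N := by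
    rw [setLIntegral_eq_lintegral_of_forall_notMem measurableSet_closedBall hout,
      lintegral_massMarginal hu.smooth hnorm, ENNReal.ofReal_natCast]
  have hle : ∫⁻ p in Metric.closedBall (0 : ℝ × ℝ) r, energyMarginal α u p ≤ ENNReal.ofReal T :=
    (setLIntegral_le_lintegral _ _).trans_eq hE
  have h := lintegral_massMarginal_sq_le (α := α) hu.smooth hr (Nat.cast_nonneg N)
    ENNReal.toReal_nonneg hM
    (ENNReal.ofReal_toReal (ne_top_of_le_ne_top ENNReal.ofReal_ne_top hle)).symm
  rw [setLIntegral_eq_lintegral_of_forall_notMem measurableSet_closedBall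
    fun p hp => by rw [hout p hp, zero_pow two_ne_zero]] at h
  refine h.trans (ENNReal.ofReal_le_ofReal ?_)
  have : (∫⁻ p in Metric.closedBall (0 : ℝ × ℝ) r, energyMarginal α u p).toReal ≤ T :=
    ENNReal.toReal_le_of_le_ofReal hT hle
  gcongr

/-- The kinetic energy inequality, in terms of marginals. -/
theorem exists_kinetic_const : ∃ C : ℝ, 0 < C ∧ ∀ (m : ℤ) (n : ℕ), Odd m → 0 < n →
    ∀ α : ℝ, α = m / n → ∀ (N : ℕ) (u : (Fin N → ℂ) → ℂ), IsAnyonWF N u →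
    ∫⁻ x, ENNReal.ofReal (‖u x‖ ^ 2) = 1 →
    ∫⁻ p, massMarginal u p ^ 2 ≤
      ENNReal.ofReal (C * n ^ 2) * ∫⁻ p, energyMarginal α u p := by
  obtain ⟨K, hK⟩ := exists_covering_const
  refine ⟨K * (1297 ^ 2 * 101) + 1297 ^ 2, by positivity, fun m n hm hn α hα N u hu hnorm => ?_⟩
  have hn' : (1 : ℝ) ≤ n ^ 2 := one_le_pow₀ (Nat.one_le_cast.2 hn)
  have hKn : 0 ≤ (K : ℝ) * (1297 ^ 2 * 101) := by positivity
  rcases eq_or_ne (∫⁻ p, energyMarginal α u p) ⊤ with hE | hE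
  · rw [hE, ENNReal.mul_top (by positivity)]
    exact le_top
  have hN := lintegral_massMarginal hu.smooth hnorm
  rcases le_total 648 N with h | h
  · obtain ⟨B, hB⟩ := exists_norm_le_of_massMarginal_ne_zero hu.compactSupport
    have h648 : (648 : ENNReal) ≤ ∫⁻ p, massMarginal u p := by
      rw [hN]
      exact_mod_cast h
    refine (hK (massMarginal u) (fun p => massMarginal u p ^ 2) (energyMarginal α u) 648 _ B
      (measurable_energyMarginal hu.smooth) (hN ▸ ENNReal.natCast_ne_top N) (by norm_num) h648 hB
      (fun p hp => by simp [hp])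
      (fun c r hr hM => lintegral_massMarginal_sq_le_energy hu hm hn hα hnorm hr hM)).trans ?_
    rw [← mul_assoc, ← ENNReal.ofReal_natCast, ← ENNReal.ofReal_mul (by positivity)]
    refine mul_le_mul_left (ENNReal.ofReal_le_ofReal ?_) _
    nlinarith
  · obtain ⟨T, hT, hTE⟩ : ∃ T : ℝ, 0 ≤ T ∧ ∫⁻ p, energyMarginal α u p = ENNReal.ofReal T :=
      ⟨_, ENNReal.toReal_nonneg, (ENNReal.ofReal_toReal hE).symm⟩
    refine (lintegral_massMarginal_sq_le_of_few hu hnorm hT hTE).trans ?_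
    rw [hTE, ← ENNReal.ofReal_mul (by positivity)]
    refine ENNReal.ofReal_le_ofReal (mul_le_mul_of_nonneg_right ?_ hT)
    have h' : (N : ℝ) ≤ 648 := by exact_mod_cast h
    calc (2 * (N : ℝ) + 1) ^ 2 ≤ (2 * (648 : ℝ) + 1) ^ 2 := by gcongr
      _ ≤ ((K : ℝ) * (1297 ^ 2 * 101) + 1297 ^ 2) * 1 := by linarith
      _ ≤ ((K : ℝ) * (1297 ^ 2 * 101) + 1297 ^ 2) * (n : ℝ) ^ 2 := by gcongr

theorem ofReal_density_le {N : ℕ} {u : (Fin N → ℂ) → ℂ} (hu : Continuous u) (y : ℂ) :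
    ENNReal.ofReal (density N u y) ≤ massMarginal u (Complex.measurableEquivRealProd y) := by
  rw [density, ENNReal.ofReal_sum_of_nonneg fun j _ => integral_nonneg fun z => by positivity]
  refine Finset.sum_le_sum fun j _ => ?_
  rw [MeasurableEquiv.symm_apply_apply, integral_eq_lintegral_of_nonneg_ae
    (Filter.Eventually.of_forall fun z => by positivity)]
  · exact ENNReal.ofReal_toReal_le
  · have h : Continuous fun z => insertAt j y z :=
      (continuous_insertAt j).comp (continuous_const.prodMk continuous_id)
    exact ((hu.comp h).norm.pow 2).aestronglyMeasurable

theorem density_nonneg {N : ℕ} (u : (Fin N → ℂ) → ℂ) (y : ℂ) : 0 ≤ density N u y :=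
  Finset.sum_nonneg fun j _ => integral_nonneg fun z => by positivity

theorem lintegral_ofReal_density_sq_le {N : ℕ} {u : (Fin N → ℂ) → ℂ}
    (hu : ContDiff ℝ (⊤ : ℕ∞) u) :
    ∫⁻ y, ENNReal.ofReal (density N u y ^ 2) ≤ ∫⁻ p, massMarginal u p ^ 2 := by
  rw [← Complex.volume_preserving_equiv_real_prod.lintegral_comp
    ((measurable_massMarginal hu).pow_const 2)]
  refine lintegral_mono fun y => ?_
  rw [ENNReal.ofReal_pow (density_nonneg u y)]
  exact pow_le_pow_left₀ zero_le (ofReal_density_le hu.continuous y) 2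

theorem ofReal_mul_le_young {d : ℝ} (hd : 0 < d) {a : ℝ} (ha : 0 ≤ a) (R : ENNReal) :
    ENNReal.ofReal a * R ≤
      ENNReal.ofReal d⁻¹ * R ^ 2 + ENNReal.ofReal (d / 4) * ENNReal.ofReal (a ^ 2) := by
  rcases eq_or_ne R ⊤ with rfl | hR
  · rw [ENNReal.top_pow two_ne_zero,
      ENNReal.mul_top (ENNReal.ofReal_pos.2 (inv_pos.2 hd)).ne', top_add]
    exact le_top
  rw [← ENNReal.ofReal_toReal hR, ← ENNReal.ofReal_pow (by positivity),
    ← ENNReal.ofReal_mul ha, ← ENNReal.ofReal_mul (by positivity),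
    ← ENNReal.ofReal_mul (by positivity), ← ENNReal.ofReal_add (by positivity) (by positivity)]
  refine ENNReal.ofReal_le_ofReal ?_
  have h : d⁻¹ * R.toReal ^ 2 + d / 4 * a ^ 2 - a * R.toReal =
      d⁻¹ * (R.toReal - d / 2 * a) ^ 2 := by field_simp; ring
  have h' : 0 ≤ d⁻¹ * (R.toReal - d / 2 * a) ^ 2 := by positivity
  linarith

/-- **Theorem (kinetic energy and Lieb–Thirring inequalities for odd-fractional anyons).**
There are universal constants `C_K, C_LT > 0` such that for every reduced fraction
`α = μ/ν` with `μ` odd and `ν > 0`, every `N ≥ 2`, and every normalized `N`-anyon wave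
function `u` with one-particle density `ρ`:
(i) `∑_j ∫ |D_j u|² ≥ (1/ν²)·C_K·∫ ρ²`, and
(ii) for every measurable `V` with square-integrable negative part `V₋`,
`∑_j ∫ (|D_j u|² + V(x_j)|u|²) ≥ −ν²·C_LT·∫ V₋²`, the left side interpreted as an
extended real (`+∞` if the positive potential term is not integrable); as in the
Lieb–Thirring corollary, (ii) is stated equivalently in `[0,∞]` as
`∑_j ∫ V₋(x_j)|u|² ≤ ∑_j ∫ (|D_j u|² + V₊(x_j)|u|²) + ν²·C_LT·∫ V₋²`. -/
theorem kinetic_and_lieb_thirring_odd_fraction :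
    ∃ CK CLT : ℝ, 0 < CK ∧ 0 < CLT ∧
      ∀ (μ : ℤ) (ν : ℕ), 0 < ν → Int.gcd μ (ν : ℤ) = 1 → Odd μ →
      ∀ α : ℝ, α = (μ : ℝ) / (ν : ℝ) →
      ∀ N : ℕ, 2 ≤ N →
      ∀ u : (Fin N → ℂ) → ℂ, IsAnyonWF N u → (∫ x : Fin N → ℂ, ‖u x‖ ^ 2) = 1 →
      (ENNReal.ofReal (1 / (ν : ℝ) ^ 2 * CK) *
          ∫⁻ y : ℂ, ENNReal.ofReal (density N u y ^ 2) ≤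
        ∑ j : Fin N, ∫⁻ x : Fin N → ℂ, ENNReal.ofReal (covSq α u j x)) ∧
      (∀ V : ℂ → ℝ, Measurable V → Integrable (fun y : ℂ => (max (-V y) 0) ^ 2) →
        ∑ j : Fin N, ∫⁻ x : Fin N → ℂ,
            ENNReal.ofReal (max (-V (x j)) 0 * ‖u x‖ ^ 2) ≤
          (∑ j : Fin N, ∫⁻ x : Fin N → ℂ,
            ENNReal.ofReal (covSq α u j x + max (V (x j)) 0 * ‖u x‖ ^ 2)) +
          ENNReal.ofReal ((ν : ℝ) ^ 2 * CLT * ∫ y : ℂ, (max (-V y) 0) ^ 2)) := by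
  obtain ⟨C, hC, hkin⟩ := exists_kinetic_const
  refine ⟨C⁻¹, C / 4, by positivity, by positivity,
    fun μ ν hν _ hμ α hα N _ u hu hnorm => ?_⟩
  have hν' : (0 : ℝ) < ν := Nat.cast_pos.2 hν
  have hnorm' : ∫⁻ x, ENNReal.ofReal (‖u x‖ ^ 2) = 1 := by
    rw [← ofReal_integral_eq_lintegral_ofReal (Integrable.of_integral_ne_zero (by simp [hnorm]))
      (Filter.Eventually.of_forall fun x => by positivity), hnorm, ENNReal.ofReal_one]
  have hsum : ∫⁻ p, energyMarginal α u p =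
      ∑ j : Fin N, ∫⁻ x : Fin N → ℂ, ENNReal.ofReal (covSq α u j x) :=
    lintegral_marginal fun j => (measurable_covSq hu.smooth j).ennreal_ofReal
  have hkey : ENNReal.ofReal (C * ν ^ 2)⁻¹ * ∫⁻ p, massMarginal u p ^ 2 ≤
      ∑ j : Fin N, ∫⁻ x : Fin N → ℂ, ENNReal.ofReal (covSq α u j x) := by
    refine (mul_le_mul_right (hkin μ ν hμ hν α hα N u hu hnorm') _).trans_eq ?_
    rw [← mul_assoc, ← ENNReal.ofReal_mul (by positivity), inv_mul_cancel₀ (by positivity),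
      ENNReal.ofReal_one, one_mul, hsum]
  refine ⟨?_, fun V hV hVint => ?_⟩
  · refine (mul_le_mul_right (lintegral_ofReal_density_sq_le hu.smooth) _).trans (le_trans ?_ hkey)
    rw [one_div, ← mul_inv, mul_comm C]
  set g : ℝ × ℝ → ENNReal := fun p =>
    ENNReal.ofReal (max (-V (Complex.measurableEquivRealProd.symm p)) 0) with hg
  have hVn : Measurable fun y => max (-V y) 0 := hV.neg.max measurable_const
  have hgm : Measurable g :=
    (hVn.comp Complex.measurableEquivRealProd.symm.measurable).ennreal_ofReal
  have hR := measurable_massMarginal hu.smooth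
  have hpot : ∑ j : Fin N, ∫⁻ x : Fin N → ℂ, ENNReal.ofReal (max (-V (x j)) 0 * ‖u x‖ ^ 2) =
      ∫⁻ p, g p * massMarginal u p := by
    rw [massMarginal, lintegral_mul_marginal (fun _ => measurable_ofReal_normSq hu.smooth) hgm]
    refine Finset.sum_congr rfl fun j _ => lintegral_congr fun x => ?_
    simp only [hg, MeasurableEquiv.symm_apply_apply]
    rw [ENNReal.ofReal_mul (le_max_right _ _)]
  have hg2 : ∫⁻ p : ℝ × ℝ, ENNReal.ofReal
      (max (-V (Complex.measurableEquivRealProd.symm p)) 0 ^ 2) =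
      ENNReal.ofReal (∫ y : ℂ, (max (-V y) 0) ^ 2) := by
    rw [ofReal_integral_eq_lintegral_ofReal hVint
      (Filter.Eventually.of_forall fun y => by positivity)]
    exact Complex.volume_preserving_equiv_real_prod.symm.lintegral_comp
      (hVn.pow_const 2).ennreal_ofReal
  rw [hpot]
  calc ∫⁻ p, g p * massMarginal u p
      ≤ ∫⁻ p, (ENNReal.ofReal (C * ν ^ 2)⁻¹ * massMarginal u p ^ 2 +
          ENNReal.ofReal (C * ν ^ 2 / 4) * ENNReal.ofReal
            (max (-V (Complex.measurableEquivRealProd.symm p)) 0 ^ 2)) :=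
        lintegral_mono fun p =>
          ofReal_mul_le_young (by positivity) (le_max_right _ _) _
    _ = ENNReal.ofReal (C * ν ^ 2)⁻¹ * (∫⁻ p, massMarginal u p ^ 2) +
          ENNReal.ofReal (C * ν ^ 2 / 4) * ENNReal.ofReal (∫ y : ℂ, (max (-V y) 0) ^ 2) := by
        rw [lintegral_add_left ((hR.pow_const 2).const_mul _),
          lintegral_const_mul _ (hR.pow_const 2), lintegral_const_mul, hg2]
        exact ((hVn.comp Complex.measurableEquivRealProd.symm.measurable).pow_const
          2).ennreal_ofReal
    _ ≤ _ := by
        refine add_le_add (hkey.trans (Finset.sum_le_sum fun j _ => lintegral_mono fun x =>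
          ENNReal.ofReal_le_ofReal (le_add_of_nonneg_right (by positivity)))) ?_
        rw [← ENNReal.ofReal_mul (by positivity)]
        refine le_of_eq ?_
        congr 1
        ring

end
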